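/- arXiv:2507.12748 — 2 statements merged into one kernel-verified Lean document; each statement's English description precedes it below -/
import Mathlib

section
/- Consider (18,6)-partitions, i.e., functions Fin 18 → Fin 6, all of whose fibers have size 3. (1) For every pair q, q' of such partitions there exists a q-cycle decomposition of (q, q') of length at most 5. (2) There exists a pair p, p' of such partitions admitting no p-cycle decomposition of (p, p') of length at most 4. (Equivalently, the combinatorial diameter of the partition polytope PP(3,3,3,3,3,3) equals 5.) -/
/-- The support of a permutation of `Fin m`, as a set. -/
def psupp {m : ℕ} (π : Equiv.Perm (Fin m)) : Set (Fin m) := {x | π x ≠ x}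

/-- A permutation `π` is `p`-balanced if `p` is injective on the support of `π`. -/
def IsBalanced {m n : ℕ} (p : Fin m → Fin n) (π : Equiv.Perm (Fin m)) : Prop :=
  Set.InjOn p (psupp π)

/-- A `p`-cycle is a `p`-balanced permutation that is the identity or a cycle. -/
def IsPCycle {m n : ℕ} (p : Fin m → Fin n) (π : Equiv.Perm (Fin m)) : Prop :=
  IsBalanced p π ∧ (π = 1 ∨ π.IsCycle)

/-- The size of the fiber of `p` over `i`. -/
def fiberCard {m n : ℕ} (p : Fin m → Fin n) (i : Fin n) : ℕ :=
  (Finset.univ.filter fun x => p x = i).card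

/-- A permutation with at most one nontrivial cycle. -/
def IsOneCycle {α : Type*} (C : Equiv.Perm α) : Prop := C = 1 ∨ C.IsCycle

theorem IsOneCycle.conj {α : Type*} {C : Equiv.Perm α} (h : IsOneCycle C) (g : Equiv.Perm α) :
    IsOneCycle (g * C * g⁻¹) := by
  rcases h with rfl | h
  · left; simp
  · exact Or.inr h.conj

/-- Permuting a transversal of the fibers of `p` along a cycle is a `p`-cycle. -/
theorem IsOneCycle.isPCycle_viaEmbedding {m n : ℕ} {p : Fin m → Fin n} {s : Fin n ↪ Fin m}
    (hs : ∀ i, p (s i) = i) {C : Equiv.Perm (Fin n)} (hC : IsOneCycle C) :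
    IsPCycle p (C.viaEmbedding s) := by
  refine ⟨?_, ?_⟩
  · intro x hx y hy hxy
    have key : ∀ x ∈ psupp (C.viaEmbedding s), ∃ i, s i = x := fun x hx => by
      by_contra h
      exact hx (Equiv.Perm.viaEmbedding_apply_of_notMem C s x h)
    obtain ⟨i, rfl⟩ := key x hx
    obtain ⟨j, rfl⟩ := key y hy
    rw [hs, hs] at hxy
    rw [hxy]
  · rcases hC with rfl | hC
    · exact Or.inl (map_one (Equiv.Perm.viaEmbeddingHom s))
    · exact Or.inr (@Equiv.Perm.IsCycle.extendDomain _ _ _ _ (fun _ => Classical.propDecidable _)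
        (Equiv.ofInjective s s.injective) hC)

/-- The function on `Fin 6` listed by `l`. -/
def ofList (l : List (Fin 6)) (i : Fin 6) : Fin 6 := l.getD i 0

/-- Test whether a permutation of `Fin 6` has at most one nontrivial cycle. -/
def oneCycleTest (f : Fin 6 → Fin 6) : Bool :=
  match [0, 1, 2, 3, 4, 5].find? fun i => f i ≠ i with
  | none => true
  | some i => [0, 1, 2, 3, 4, 5].all fun j => f j = j || (List.iterate f i 6).elem j

theorem mem_fin_six (i : Fin 6) : i ∈ [(0 : Fin 6), 1, 2, 3, 4, 5] := by
  revert i; decide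

theorem oneCycleTest_iff (C : Equiv.Perm (Fin 6)) : oneCycleTest C = true ↔ IsOneCycle C := by
  unfold oneCycleTest
  split
  · rename_i h
    rw [List.find?_eq_none] at h
    refine iff_of_true rfl (Or.inl (Equiv.ext fun i => ?_))
    simpa using h i (mem_fin_six i)
  · rename_i i h
    have hi : C i ≠ i := by simpa using List.find?_some h
    have hne : C ≠ 1 := by rintro rfl; exact hi rfl
    rw [IsOneCycle, or_iff_right hne, List.all_eq_true]
    constructor
    · intro H
      refine ⟨i, hi, fun j hj => ?_⟩
      have := H j (mem_fin_six j)
      simp only [hj, decide_false, Bool.false_or, List.elem_eq_mem, decide_eq_true_eq,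
        List.mem_iterate] at this
      obtain ⟨n, -, rfl⟩ := this
      exact ⟨n, by rw [zpow_natCast, Equiv.Perm.coe_pow]⟩
    · intro H j _
      by_cases hj : C j = j
      · simp [hj]
      · obtain ⟨n, hn, rfl⟩ := (H.sameCycle hi hj).exists_pow_eq_of_mem_support
          (Equiv.Perm.mem_support.2 hi)
        have h6 : n < 6 := hn.trans_le ((Finset.card_le_univ _).trans_eq (by simp))
        simp only [List.elem_eq_mem, Bool.or_eq_true, decide_eq_true_eq, List.mem_iterate]
        exact Or.inr ⟨n, h6, by rw [Equiv.Perm.coe_pow]⟩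

/-- On two layers of `Fin 6`, move the points picked by `k` along `f`. -/
def moveSlot (k : Fin 6 → Bool) (f : Fin 6 → Fin 6) (x : Fin 6 × Bool) : Fin 6 × Bool :=
  if x.2 = k x.1 then (f x.1, k (f x.1)) else x

/-- The permutations `P` and `Q` of two layers of `Fin 6` are jointly realized, up to the choice
of layers, by three moves along cycles. -/
def PairSolvable (P Q : Equiv.Perm (Fin 6)) : Prop :=
  ∃ (k₁ k₂ k₃ : Fin 6 → Bool) (C₁ C₂ C₃ : Equiv.Perm (Fin 6)),
    IsOneCycle C₁ ∧ IsOneCycle C₂ ∧ IsOneCycle C₃ ∧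
    ∀ i, (moveSlot k₁ C₁ (moveSlot k₂ C₂ (moveSlot k₃ C₃ (i, false)))).1 = P i ∧
      (moveSlot k₁ C₁ (moveSlot k₂ C₂ (moveSlot k₃ C₃ (i, true)))).1 = Q i

theorem moveSlot_conj (k : Fin 6 → Bool) (C g : Equiv.Perm (Fin 6)) (x : Fin 6 × Bool) :
    moveSlot (k ∘ g.symm) (g * C * g⁻¹ : Equiv.Perm (Fin 6)) (Prod.map g id x) =
      Prod.map g id (moveSlot k C x) := by
  by_cases h : x.2 = k x.1 <;> simp [moveSlot, h]

theorem PairSolvable.conj {P Q : Equiv.Perm (Fin 6)} (h : PairSolvable P Q)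
    (g : Equiv.Perm (Fin 6)) : PairSolvable (g * P * g⁻¹) (g * Q * g⁻¹) := by
  obtain ⟨k₁, k₂, k₃, C₁, C₂, C₃, h₁, h₂, h₃, h⟩ := h
  refine ⟨k₁ ∘ g.symm, k₂ ∘ g.symm, k₃ ∘ g.symm, _, _, _, h₁.conj g, h₂.conj g, h₃.conj g,
    fun i => ?_⟩
  have key : ∀ b, ((i, b) : Fin 6 × Bool) = Prod.map g id (g⁻¹ i, b) := fun b => by simp
  rw [key, key]
  simp only [moveSlot_conj]
  simp only [Prod.map_fst, h]
  simp

/-- A realization on two layers, transported to two disjoint transversals. -/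
theorem PairSolvable.exists_pCycles {m : ℕ} {p : Fin m → Fin 6} {u v : Fin 6 → Fin m}
    (hu : ∀ i, p (u i) = i) (hv : ∀ i, p (v i) = i) (huv : ∀ i j, u i ≠ v j)
    {P Q : Equiv.Perm (Fin 6)} (h : PairSolvable P Q) :
    ∃ σ₁ σ₂ σ₃ : Equiv.Perm (Fin m), IsPCycle p σ₁ ∧ IsPCycle p σ₂ ∧ IsPCycle p σ₃ ∧
      (∀ i, p (σ₁ (σ₂ (σ₃ (u i)))) = P i) ∧ (∀ i, p (σ₁ (σ₂ (σ₃ (v i)))) = Q i) ∧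
      ∀ x, (∀ i, u i ≠ x) → (∀ i, v i ≠ x) → σ₁ (σ₂ (σ₃ x)) = x := by
  obtain ⟨k₁, k₂, k₃, C₁, C₂, C₃, h₁, h₂, h₃, h⟩ := h
  let w : Fin 6 × Bool → Fin m := fun x => bif x.2 then v x.1 else u x.1
  have hw : ∀ x, p (w x) = x.1 := by rintro ⟨i, _ | _⟩ <;> simp [w, hu, hv]
  have hwinj : Function.Injective w := by
    rintro ⟨i, b⟩ ⟨j, c⟩ hxy
    have hij : i = j := by simpa [hw] using congrArg p hxy
    subst hij
    cases b <;> cases c <;> first | rfl | (exfalso; simp only [w, cond_true, cond_false] at hxy)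
    · exact huv _ _ hxy
    · exact huv _ _ hxy.symm
  let s : (Fin 6 → Bool) → Fin 6 ↪ Fin m := fun k =>
    ⟨fun i => w (i, k i), fun i j hij => (Prod.ext_iff.1 (hwinj hij)).1⟩
  have hs : ∀ k i, p (s k i) = i := fun k i => hw _
  have hmove : ∀ k (C : Equiv.Perm (Fin 6)) x, C.viaEmbedding (s k) (w x) = w (moveSlot k C x) := by
    rintro k C ⟨i, b⟩
    by_cases hb : b = k i
    · subst hb
      simp only [moveSlot, if_true]
      exact C.viaEmbedding_apply (s k) i
    · simp only [moveSlot, hb, if_false]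
      apply Equiv.Perm.viaEmbedding_apply_of_notMem
      rintro ⟨j, hj⟩
      have := hwinj hj
      simp only [Prod.mk.injEq] at this
      obtain ⟨rfl, h⟩ := this
      exact hb h.symm
  have hfix : ∀ k (C : Equiv.Perm (Fin 6)) x, (∀ i, u i ≠ x) → (∀ i, v i ≠ x) →
      C.viaEmbedding (s k) x = x := by
    intro k C x hux hvx
    apply Equiv.Perm.viaEmbedding_apply_of_notMem
    rintro ⟨j, hj⟩
    change w (j, k j) = x at hj
    cases hk : k j <;> rw [hk] at hj
    exacts [hux j hj, hvx j hj]
  refine ⟨C₁.viaEmbedding (s k₁), C₂.viaEmbedding (s k₂), C₃.viaEmbedding (s k₃),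
    h₁.isPCycle_viaEmbedding (hs k₁), h₂.isPCycle_viaEmbedding (hs k₂),
    h₃.isPCycle_viaEmbedding (hs k₃), fun i => ?_, fun i => ?_, fun x hux hvx => ?_⟩
  · have : u i = w (i, false) := rfl
    rw [this, hmove, hmove, hmove, hw, (h i).1]
  · have : v i = w (i, true) := rfl
    rw [this, hmove, hmove, hmove, hw, (h i).2]
  · rw [hfix k₃ C₃ x hux hvx, hfix k₂ C₂ x hux hvx, hfix k₁ C₁ x hux hvx]

/-- The value of the move with mask `s.1` along the permutation listed by `s.2`. -/
def moveBy (s : ℕ × List (Fin 6)) : Fin 6 × Bool → Fin 6 × Bool :=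
  moveSlot (fun i => s.1.testBit i) (ofList s.2)

/-- Test whether a list describes a permutation with at most one nontrivial cycle. -/
def cycleListTest (l : List (Fin 6)) : Bool :=
  l.length = 6 && l.Nodup && oneCycleTest (ofList l)

theorem exists_isOneCycle_of_cycleListTest {l : List (Fin 6)} (h : cycleListTest l = true) :
    ∃ C : Equiv.Perm (Fin 6), ⇑C = ofList l ∧ IsOneCycle C := by
  simp only [cycleListTest, Bool.and_eq_true, decide_eq_true_eq] at h
  obtain ⟨⟨hl, hnd⟩, hc⟩ := h
  have hinj : Function.Injective (ofList l) := by
    intro i j hij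
    have hi : (i : ℕ) < l.length := by rw [hl]; exact i.2
    have hj : (j : ℕ) < l.length := by rw [hl]; exact j.2
    simp only [ofList, List.getD_eq_getElem _ _ hi, List.getD_eq_getElem _ _ hj] at hij
    exact Fin.ext ((List.Nodup.getElem_inj_iff hnd).1 hij)
  refine ⟨Equiv.ofBijective _ (Finite.injective_iff_bijective.1 hinj), rfl, ?_⟩
  rw [← oneCycleTest_iff]
  exact hc

/-- Test whether the moves `c`, `b`, `a`, made in this order, realize `P` and `Q`. -/
def solves (P Q : Fin 6 → Fin 6) (a b c : ℕ × List (Fin 6)) : Bool :=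
  cycleListTest a.2 && cycleListTest b.2 && cycleListTest c.2 &&
  [0, 1, 2, 3, 4, 5].all fun i =>
    (moveBy a (moveBy b (moveBy c (i, false)))).1 = P i &&
    (moveBy a (moveBy b (moveBy c (i, true)))).1 = Q i

theorem pairSolvable_of_solves {P Q : Equiv.Perm (Fin 6)} {a b c : ℕ × List (Fin 6)}
    (h : solves P Q a b c = true) : PairSolvable P Q := by
  simp only [solves, Bool.and_eq_true, List.all_eq_true, decide_eq_true_eq] at h
  obtain ⟨⟨⟨ha, hb⟩, hc⟩, h⟩ := h
  obtain ⟨A, hA, hA'⟩ := exists_isOneCycle_of_cycleListTest ha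
  obtain ⟨B, hB, hB'⟩ := exists_isOneCycle_of_cycleListTest hb
  obtain ⟨C, hC, hC'⟩ := exists_isOneCycle_of_cycleListTest hc
  refine ⟨fun i => a.1.testBit i, fun i => b.1.testBit i, fun i => c.1.testBit i, A, B, C,
    hA', hB', hC', fun i => ?_⟩
  rw [hA, hB, hC]
  exact h i (mem_fin_six i)

/-- All ways to distribute a list of pairs over two layers so that no layer repeats a value. -/
def splittings : List (Fin 6 × Fin 6) → List (ℕ × List (Fin 6) × List (Fin 6))
  | [] => [(0, [], [])]
  | (a, b) :: r => (splittings r).flatMap fun x =>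
    (if a ∉ x.2.1 ∧ b ∉ x.2.2 then [(2 * x.1, a :: x.2.1, b :: x.2.2)] else []) ++
    (if a ≠ b ∧ b ∉ x.2.1 ∧ a ∉ x.2.2 then [(2 * x.1 + 1, b :: x.2.1, a :: x.2.2)] else [])

/-- The targets of the points of the two layers after the move `c`. -/
def targetsAfter (P Q : Fin 6 → Fin 6) (c : ℕ × List (Fin 6)) : List (Fin 6 × Fin 6) :=
  [0, 1, 2, 3, 4, 5].map fun j =>
    let i : Fin 6 := Fin.ofNat 6 (c.2.idxOf j)
    let t := if c.1.testBit i then Q i else P i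
    if c.1.testBit j then (P j, t) else (t, Q j)

/-- Search for a realization of `P` and `Q` whose first move belongs to `T`. -/
def solvable (P Q : Fin 6 → Fin 6) (T : List (ℕ × List (Fin 6))) : Bool :=
  T.any fun c => (splittings (targetsAfter P Q c)).any fun x =>
    oneCycleTest (ofList x.2.1) && oneCycleTest (ofList x.2.2) &&
    solves P Q (x.1, x.2.1) (63 - x.1, x.2.2) c

theorem pairSolvable_of_solvable {P Q : Equiv.Perm (Fin 6)} {T : List (ℕ × List (Fin 6))}
    (h : solvable P Q T = true) : PairSolvable P Q := by
  simp only [solvable, List.any_eq_true, Bool.and_eq_true] at h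
  obtain ⟨_, -, _, -, -, h⟩ := h
  exact pairSolvable_of_solves h

/-- The list of values of a function on `Fin 6`. -/
def toList (f : Fin 6 → Fin 6) : List (Fin 6) := [f 0, f 1, f 2, f 3, f 4, f 5]

theorem ofList_toList (f : Fin 6 → Fin 6) : ofList (toList f) = f := by
  ext i; fin_cases i <;> rfl

theorem toList_mem_permutations (Q : Equiv.Perm (Fin 6)) :
    toList Q ∈ List.permutations' [0, 1, 2, 3, 4, 5] := by
  rw [List.mem_permutations']
  exact Equiv.Perm.ofFn_comp_perm Q id

/-- Search for realizations of `P` with every `Q` that is not a cycle, up to conjugation by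
the elements of `Z`; the moves in `d` serve for `Q = P`. -/
def searchAll (P : Equiv.Perm (Fin 6)) (Z : List (Equiv.Perm (Fin 6)))
    (d : (ℕ × List (Fin 6)) × (ℕ × List (Fin 6)) × (ℕ × List (Fin 6)))
    (T : List (ℕ × List (Fin 6))) : Bool :=
  (Z.all fun g => [0, 1, 2, 3, 4, 5].all fun i => g (P (g.symm i)) = P i) &&
  solves P P d.1 d.2.1 d.2.2 &&
  (List.permutations' [0, 1, 2, 3, 4, 5]).all fun q =>
    q = toList P || oneCycleTest (ofList q) ||
    (Z.any fun g => (toList fun i => g (ofList q (g.symm i))) < q) ||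
    solvable P (ofList q) T

theorem pairSolvable_of_searchAll {P : Equiv.Perm (Fin 6)} {Z : List (Equiv.Perm (Fin 6))}
    {d : (ℕ × List (Fin 6)) × (ℕ × List (Fin 6)) × (ℕ × List (Fin 6))}
    {T : List (ℕ × List (Fin 6))} (h : searchAll P Z d T = true) (Q : Equiv.Perm (Fin 6))
    (hQ : ¬ IsOneCycle Q) : PairSolvable P Q := by
  simp only [searchAll, Bool.and_eq_true, List.all_eq_true, decide_eq_true_eq] at h
  obtain ⟨⟨hZ, hd⟩, h⟩ := h
  have hwf : WellFounded fun A B : Equiv.Perm (Fin 6) => toList A < toList B :=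
    @Finite.wellFounded_of_trans_of_irrefl _ _ _ ⟨fun _ _ _ => lt_trans⟩ ⟨fun _ => lt_irrefl _⟩
  induction Q using hwf.induction with
  | _ Q ih =>
  have := h _ (toList_mem_permutations Q)
  simp only [Bool.or_eq_true, ofList_toList, decide_eq_true_eq, List.any_eq_true,
    oneCycleTest_iff, hQ, or_false] at this
  rcases this with (hPQ | ⟨g, hg, hlt⟩) | hs
  · have : Q = P := by
      rw [← DFunLike.coe_fn_eq, ← ofList_toList Q, hPQ, ofList_toList]
    rw [this]
    exact pairSolvable_of_solves hd
  · have hgP : g * P * g⁻¹ = P := Equiv.ext fun i => hZ g hg i (mem_fin_six i)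
    have hg' : g⁻¹ * (g * Q * g⁻¹) * g⁻¹⁻¹ = Q := by group
    have hQ' : ¬ IsOneCycle (g * Q * g⁻¹) := fun hc => hQ (hg' ▸ hc.conj g⁻¹)
    have := (ih (g * Q * g⁻¹) hlt hQ').conj g⁻¹
    rw [hg'] at this
    convert this using 1
    nth_rewrite 2 [← hgP]
    group
  · exact pairSolvable_of_solvable hs

/-- The permutation listed by `a`, with inverse listed by `b`. -/
def permOfLists (a b : List (Fin 6)) (hab : ∀ i, ofList b (ofList a i) = i)
    (hba : ∀ i, ofList a (ofList b i) = i) : Equiv.Perm (Fin 6) :=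
  ⟨ofList a, ofList b, hab, hba⟩

set_option maxRecDepth 100000

/-- The permutation `(2 3)(4 5)` of `Fin 6`. -/
def doubleSwap : Equiv.Perm (Fin 6) :=
  permOfLists [0, 1, 3, 2, 5, 4] [0, 1, 3, 2, 5, 4] (by decide) (by decide)

theorem pairSolvable_doubleSwap (Q : Equiv.Perm (Fin 6)) (hQ : ¬ IsOneCycle Q) :
    PairSolvable doubleSwap Q := by
  refine pairSolvable_of_searchAll (Z :=
    [permOfLists [0, 1, 4, 5, 3, 2] [0, 1, 5, 4, 2, 3] (by decide) (by decide),
     permOfLists [0, 1, 3, 2, 4, 5] [0, 1, 3, 2, 4, 5] (by decide) (by decide),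
     permOfLists [0, 1, 2, 3, 5, 4] [0, 1, 2, 3, 5, 4] (by decide) (by decide),
     permOfLists [1, 0, 4, 5, 2, 3] [1, 0, 4, 5, 2, 3] (by decide) (by decide)])
    (d := ((52, [0, 1, 3, 4, 5, 2]),
     (40, [0, 1, 3, 5, 2, 4]),
     (0, [0, 1, 2, 4, 5, 3])))
    (T := [(35, [1, 2, 3, 4, 5, 0]),
     (19, [2, 0, 3, 5, 1, 4]),
     (43, [3, 4, 0, 5, 2, 1]),
     (7, [5, 4, 1, 0, 3, 2]),
     (6, [0, 5, 4, 1, 3, 2])]) ?_ Q hQ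
  decide +kernel

/-- The permutation `(1 2)(3 4 5)` of `Fin 6`. -/
def swapThree : Equiv.Perm (Fin 6) :=
  permOfLists [0, 2, 1, 4, 5, 3] [0, 2, 1, 5, 3, 4] (by decide) (by decide)

theorem pairSolvable_swapThree (Q : Equiv.Perm (Fin 6)) (hQ : ¬ IsOneCycle Q) :
    PairSolvable swapThree Q := by
  refine pairSolvable_of_searchAll (Z :=
    [permOfLists [0, 1, 2, 5, 3, 4] [0, 1, 2, 4, 5, 3] (by decide) (by decide),
     permOfLists [0, 2, 1, 3, 4, 5] [0, 2, 1, 3, 4, 5] (by decide) (by decide),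
     permOfLists [0, 2, 1, 4, 5, 3] [0, 2, 1, 5, 3, 4] (by decide) (by decide)])
    (d := ((58, [0, 2, 5, 4, 1, 3]),
     (20, [0, 2, 4, 1, 5, 3]),
     (0, [0, 1, 3, 4, 2, 5])))
    (T := [(41, [1, 2, 3, 4, 5, 0]),
     (25, [5, 2, 4, 1, 0, 3]),
     (11, [1, 3, 0, 4, 5, 2]),
     (9, [1, 4, 3, 5, 2, 0]),
     (40, [0, 3, 4, 2, 5, 1])]) ?_ Q hQ
  decide +kernel

/-- The permutation `(0 1)(2 3)(4 5)` of `Fin 6`. -/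
def tripleSwap : Equiv.Perm (Fin 6) :=
  permOfLists [1, 0, 3, 2, 5, 4] [1, 0, 3, 2, 5, 4] (by decide) (by decide)

theorem pairSolvable_tripleSwap (Q : Equiv.Perm (Fin 6)) (hQ : ¬ IsOneCycle Q) :
    PairSolvable tripleSwap Q := by
  refine pairSolvable_of_searchAll (Z :=
    [permOfLists [3, 2, 4, 5, 0, 1] [4, 5, 1, 0, 2, 3] (by decide) (by decide),
     permOfLists [0, 1, 2, 3, 5, 4] [0, 1, 2, 3, 5, 4] (by decide) (by decide),
     permOfLists [0, 1, 4, 5, 3, 2] [0, 1, 5, 4, 2, 3] (by decide) (by decide),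
     permOfLists [0, 1, 3, 2, 4, 5] [0, 1, 3, 2, 4, 5] (by decide) (by decide)])
    (d := ((61, [1, 4, 3, 0, 5, 2]),
     (42, [1, 3, 0, 5, 2, 4]),
     (0, [0, 2, 3, 4, 5, 1])))
    (T := [(22, [1, 2, 4, 0, 5, 3]),
     (41, [5, 2, 3, 0, 1, 4]),
     (9, [2, 3, 4, 5, 1, 0]),
     (18, [5, 3, 4, 0, 1, 2]),
     (5, [3, 2, 4, 5, 0, 1]),
     (26, [1, 4, 0, 5, 3, 2])]) ?_ Q hQ
  decide +kernel

/-- The permutation `(0 1)(2 3 4 5)` of `Fin 6`. -/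
def swapFour : Equiv.Perm (Fin 6) :=
  permOfLists [1, 0, 3, 4, 5, 2] [1, 0, 5, 2, 3, 4] (by decide) (by decide)

theorem pairSolvable_swapFour (Q : Equiv.Perm (Fin 6)) (hQ : ¬ IsOneCycle Q) :
    PairSolvable swapFour Q := by
  refine pairSolvable_of_searchAll (Z :=
    [permOfLists [0, 1, 5, 2, 3, 4] [0, 1, 3, 4, 5, 2] (by decide) (by decide),
     permOfLists [1, 0, 3, 4, 5, 2] [1, 0, 5, 2, 3, 4] (by decide) (by decide),
     permOfLists [1, 0, 4, 5, 2, 3] [1, 0, 4, 5, 2, 3] (by decide) (by decide)])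
    (d := ((61, [1, 4, 3, 0, 5, 2]),
     (10, [1, 3, 0, 4, 5, 2]),
     (0, [0, 2, 3, 1, 4, 5])))
    (T := [(38, [1, 2, 5, 4, 0, 3]),
     (13, [3, 4, 0, 1, 5, 2]),
     (49, [5, 2, 3, 4, 0, 1]),
     (38, [3, 4, 1, 2, 5, 0]),
     (12, [0, 3, 1, 2, 4, 5])]) ?_ Q hQ
  decide +kernel

/-- The permutation `(0 1 2)(3 4 5)` of `Fin 6`. -/
def threeThree : Equiv.Perm (Fin 6) :=
  permOfLists [1, 2, 0, 4, 5, 3] [2, 0, 1, 5, 3, 4] (by decide) (by decide)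

theorem pairSolvable_threeThree (Q : Equiv.Perm (Fin 6)) (hQ : ¬ IsOneCycle Q) :
    PairSolvable threeThree Q := by
  refine pairSolvable_of_searchAll (Z :=
    [permOfLists [0, 1, 2, 5, 3, 4] [0, 1, 2, 4, 5, 3] (by decide) (by decide),
     permOfLists [1, 2, 0, 4, 5, 3] [2, 0, 1, 5, 3, 4] (by decide) (by decide),
     permOfLists [2, 0, 1, 4, 5, 3] [1, 2, 0, 5, 3, 4] (by decide) (by decide),
     permOfLists [4, 5, 3, 2, 0, 1] [4, 5, 3, 2, 0, 1] (by decide) (by decide)])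
    (d := ((59, [1, 2, 5, 4, 0, 3]),
     (20, [1, 2, 4, 0, 5, 3]),
     (0, [0, 1, 3, 4, 2, 5])))
    (T := [(46, [1, 2, 3, 5, 0, 4]),
     (37, [3, 2, 5, 4, 1, 0]),
     (50, [4, 5, 3, 0, 1, 2]),
     (3, [4, 3, 0, 5, 1, 2]),
     (10, [1, 3, 4, 5, 0, 2])]) ?_ Q hQ
  decide +kernel

theorem IsOneCycle.of_card_cycleType_le_one {α : Type*} [Fintype α] [DecidableEq α]
    {P : Equiv.Perm α} (h : P.cycleType.card ≤ 1) : IsOneCycle P := by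
  rcases Nat.le_one_iff_eq_zero_or_eq_one.1 h with h | h
  · exact Or.inl (Equiv.Perm.card_cycleType_eq_zero.1 h)
  · exact Or.inr (Equiv.Perm.card_cycleType_eq_one.1 h)

theorem cycleType_formPerm_of_nodup {α : Type*} [Fintype α] [DecidableEq α] {l : List α}
    (hl : l.Nodup) (h2 : 2 ≤ l.length) : l.formPerm.cycleType = {l.length} := by
  rw [(List.isCycle_formPerm hl h2).cycleType, List.support_formPerm_of_nodup l hl,
    List.toFinset_card_of_nodup hl]
  rintro x rfl
  simp at h2

theorem isConj_of_eq_formPerm_mul {P R : Equiv.Perm (Fin 6)} {l l' : List (Fin 6)}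
    (hl : l.Nodup) (hl' : l'.Nodup) (h2 : 2 ≤ l.length) (h2' : 2 ≤ l'.length)
    (hR : R = l.formPerm * l'.formPerm) (hd : ∀ x ∈ l, x ∉ l')
    (hP : P.cycleType = {l.length, l'.length}) : IsConj P R := by
  rw [Equiv.Perm.isConj_iff_cycleType_eq, hP, hR, Equiv.Perm.Disjoint.cycleType_mul,
    cycleType_formPerm_of_nodup hl h2, cycleType_formPerm_of_nodup hl' h2']
  · rfl
  · exact (List.formPerm_disjoint_iff hl hl' h2 h2').2 hd

/-- A permutation of `Fin 6` with several nontrivial cycles is conjugate to one of five. -/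
theorem isConj_of_not_isOneCycle {P : Equiv.Perm (Fin 6)} (hP : ¬ IsOneCycle P) :
    IsConj P doubleSwap ∨ IsConj P swapThree ∨ IsConj P tripleSwap ∨ IsConj P swapFour ∨
      IsConj P threeThree := by
  have hcard : 2 ≤ P.cycleType.card := by
    by_contra h
    exact hP (.of_card_cycleType_le_one (by omega))
  have hsum : P.cycleType.sum ≤ 6 := by
    rw [Equiv.Perm.sum_cycleType]
    exact (Finset.card_le_univ _).trans_eq (by simp)
  have htwo : ∀ n ∈ P.cycleType, 2 ≤ n := fun n hn => Equiv.Perm.two_le_of_mem_cycleType hn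
  have hcard' : P.cycleType.card ≤ 3 := by
    have := Multiset.card_nsmul_le_sum htwo
    simp only [smul_eq_mul] at this
    omega
  obtain h | h : P.cycleType.card = 2 ∨ P.cycleType.card = 3 := by omega
  · obtain ⟨a, b, hab⟩ := Multiset.card_eq_two.1 h
    wlog hle : a ≤ b generalizing a b
    · exact this b a (by rw [hab, Multiset.pair_comm]) (by omega)
    have ha : 2 ≤ a := htwo a (by simp [hab])
    have hs : a + b ≤ 6 := by simpa [hab] using hsum
    obtain ⟨rfl, rfl⟩ | ⟨rfl, rfl⟩ | ⟨rfl, rfl⟩ | ⟨rfl, rfl⟩ :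
      a = 2 ∧ b = 2 ∨ a = 2 ∧ b = 3 ∨ a = 2 ∧ b = 4 ∨ a = 3 ∧ b = 3 := by omega
    · exact Or.inl <| isConj_of_eq_formPerm_mul (l := [2, 3]) (l' := [4, 5]) (by decide)
        (by decide) (by decide) (by decide) (by decide) (by decide) hab
    · exact Or.inr <| Or.inl <| isConj_of_eq_formPerm_mul (l := [1, 2]) (l' := [3, 4, 5])
        (by decide) (by decide) (by decide) (by decide) (by decide) (by decide) hab
    · exact Or.inr <| Or.inr <| Or.inr <| Or.inl <| isConj_of_eq_formPerm_mul (l := [0, 1])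
        (l' := [2, 3, 4, 5]) (by decide) (by decide) (by decide) (by decide) (by decide)
        (by decide) hab
    · exact Or.inr <| Or.inr <| Or.inr <| Or.inr <| isConj_of_eq_formPerm_mul (l := [0, 1, 2])
        (l' := [3, 4, 5]) (by decide) (by decide) (by decide) (by decide) (by decide)
        (by decide) hab
  · obtain ⟨a, b, c, habc⟩ := Multiset.card_eq_three.1 h
    have ha : 2 ≤ a := htwo a (by simp [habc])
    have hb : 2 ≤ b := htwo b (by simp [habc])
    have hc : 2 ≤ c := htwo c (by simp [habc])
    have hs : a + (b + c) ≤ 6 := by simpa [habc] using hsum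
    obtain ⟨rfl, rfl, rfl⟩ : a = 2 ∧ b = 2 ∧ c = 2 := by omega
    refine Or.inr <| Or.inr <| Or.inl ?_
    have hR : tripleSwap = ([0, 1] : List (Fin 6)).formPerm *
      (([2, 3] : List (Fin 6)).formPerm * ([4, 5] : List (Fin 6)).formPerm) := by decide
    rw [Equiv.Perm.isConj_iff_cycleType_eq, habc, hR, Equiv.Perm.Disjoint.cycleType_mul,
      Equiv.Perm.Disjoint.cycleType_mul, cycleType_formPerm_of_nodup, cycleType_formPerm_of_nodup,
      cycleType_formPerm_of_nodup]
    all_goals first | rfl | decide | (intro x; revert x; decide)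

/-- A property of permutations of `Fin 6` that is invariant under conjugation and holds for
one permutation of each cycle type with several parts holds for those that are not cycles. -/
theorem not_isOneCycle_induction {p : Equiv.Perm (Fin 6) → Prop}
    (hconj : ∀ P g, p P → p (g * P * g⁻¹)) (h₁ : p doubleSwap) (h₂ : p swapThree)
    (h₃ : p tripleSwap) (h₄ : p swapFour) (h₅ : p threeThree) {P : Equiv.Perm (Fin 6)}
    (hP : ¬ IsOneCycle P) : p P := by
  have key : ∀ R, p R → IsConj P R → p P := fun R hR h => by
    obtain ⟨g, rfl⟩ := isConj_iff.1 h.symm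
    exact hconj R g hR
  rcases isConj_of_not_isOneCycle hP with h | h | h | h | h
  exacts [key _ h₁ h, key _ h₂ h, key _ h₃ h, key _ h₄ h, key _ h₅ h]

theorem exists_eq_mul_of_lists {P : Equiv.Perm (Fin 6)} (c t : List (Fin 6))
    (hc : cycleListTest c = true) (ht : cycleListTest t = true)
    (h : ∀ i, P i = ofList c (ofList t i)) :
    ∃ C T, IsOneCycle C ∧ IsOneCycle T ∧ P = C * T := by
  obtain ⟨C, hC, hC'⟩ := exists_isOneCycle_of_cycleListTest hc
  obtain ⟨T, hT, hT'⟩ := exists_isOneCycle_of_cycleListTest ht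
  exact ⟨C, T, hC', hT', Equiv.ext fun i => by rw [h, Equiv.Perm.mul_apply, hC, hT]⟩

/-- Every permutation of `Fin 6` is a product of two cycles. -/
theorem exists_isOneCycle_mul (P : Equiv.Perm (Fin 6)) :
    ∃ C T, IsOneCycle C ∧ IsOneCycle T ∧ P = C * T := by
  by_cases hP : IsOneCycle P
  · exact ⟨P, 1, hP, Or.inl rfl, (mul_one P).symm⟩
  refine not_isOneCycle_induction (p := fun P => ∃ C T, IsOneCycle C ∧ IsOneCycle T ∧ P = C * T)
    ?_ ?_ ?_ ?_ ?_ ?_ hP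
  · rintro _ g ⟨C, T, hC, hT, rfl⟩
    exact ⟨_, _, hC.conj g, hT.conj g, by group⟩
  · exact exists_eq_mul_of_lists [0, 1, 3, 2, 4, 5] [0, 1, 2, 3, 5, 4] (by decide) (by decide)
      (by decide)
  · exact exists_eq_mul_of_lists [0, 2, 4, 1, 5, 3] [0, 1, 3, 2, 4, 5] (by decide) (by decide)
      (by decide)
  · exact exists_eq_mul_of_lists [1, 5, 0, 2, 3, 4] [0, 2, 4, 3, 1, 5] (by decide) (by decide)
      (by decide)
  · exact exists_eq_mul_of_lists [1, 3, 0, 4, 5, 2] [0, 2, 1, 3, 4, 5] (by decide) (by decide)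
      (by decide)
  · exact exists_eq_mul_of_lists [1, 2, 4, 0, 5, 3] [0, 1, 3, 2, 4, 5] (by decide) (by decide)
      (by decide)

theorem moveSlot_const_self (b : Bool) (f : Fin 6 → Fin 6) (i : Fin 6) :
    moveSlot (fun _ => b) f (i, b) = (f i, b) := by simp [moveSlot]

theorem moveSlot_const_of_ne {b c : Bool} (h : c ≠ b) (f : Fin 6 → Fin 6) (i : Fin 6) :
    moveSlot (fun _ => b) f (i, c) = (i, c) := by simp [moveSlot, h]

/-- Any two permutations of two layers of `Fin 6` are jointly realized by three moves. -/
theorem pairSolvable (P Q : Equiv.Perm (Fin 6)) : PairSolvable P Q := by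
  by_cases hP : IsOneCycle P
  · obtain ⟨C, T, hC, hT, rfl⟩ := exists_isOneCycle_mul Q
    refine ⟨fun _ => true, fun _ => true, fun _ => false, C, T, P, hC, hT, hP, fun i => ?_⟩
    simp [moveSlot_const_self, moveSlot_const_of_ne]
  by_cases hQ : IsOneCycle Q
  · obtain ⟨C, T, hC, hT, rfl⟩ := exists_isOneCycle_mul P
    refine ⟨fun _ => false, fun _ => false, fun _ => true, C, T, Q, hC, hT, hQ, fun i => ?_⟩
    simp [moveSlot_const_self, moveSlot_const_of_ne]
  refine not_isOneCycle_induction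
    (p := fun P => ∀ Q : Equiv.Perm (Fin 6), ¬ IsOneCycle Q → PairSolvable P Q)
    ?_ pairSolvable_doubleSwap pairSolvable_swapThree pairSolvable_tripleSwap
    pairSolvable_swapFour pairSolvable_threeThree hP Q hQ
  intro P g h Q hQ
  have hQ' : Q = g * (g⁻¹ * Q * g) * g⁻¹ := by group
  rw [hQ']
  refine (h _ fun hc => hQ ?_).conj g
  rw [hQ']
  exact hc.conj g

theorem card_filter_sdiff_image {α β : Type*} [DecidableEq α] [DecidableEq β] [Fintype β]
    {S : Finset α} {f : α → β} {s : β → α} {r : ℕ} (hs : ∀ i, s i ∈ S)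
    (hf : Function.Bijective (f ∘ s)) (h : ∀ i, (S.filter fun x => f x = i).card = r + 1) (i : β) :
    ((S \ Finset.univ.image s).filter fun x => f x = i).card = r := by
  obtain ⟨j, rfl⟩ := hf.2 i
  have : ((S \ Finset.univ.image s).filter fun x => f x = (f ∘ s) j) =
      (S.filter fun x => f x = (f ∘ s) j).erase (s j) := by
    ext x
    simp only [Finset.mem_filter, Finset.mem_sdiff, Finset.mem_image, Finset.mem_univ, true_and,
      Finset.mem_erase]
    constructor
    · rintro ⟨⟨hx, hx'⟩, hfx⟩
      exact ⟨fun h => hx' ⟨j, h.symm⟩, hx, hfx⟩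
    · rintro ⟨hne, hx, hfx⟩
      refine ⟨⟨hx, ?_⟩, hfx⟩
      rintro ⟨k, rfl⟩
      exact hne (congrArg s (hf.1 hfx))
  rw [this, Finset.card_erase_of_mem (by simp [hs]), h, Nat.add_sub_cancel]

theorem card_filter_mem {α β : Type*} [DecidableEq β] {S : Finset α} {f : α → β} {r : ℕ}
    (h : ∀ i, (S.filter fun x => f x = i).card = r) (A : Finset β) :
    (S.filter fun x => f x ∈ A).card = A.card * r := by
  rw [Finset.card_eq_sum_card_fiberwise (f := f) (t := A) (fun x hx => by simp_all)]
  rw [Finset.sum_congr rfl (g := fun _ => r), Finset.sum_const, smul_eq_mul]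
  intro i hi
  rw [← h i, Finset.filter_filter]
  congr 1
  ext x
  simp only [Finset.mem_filter]
  constructor
  · tauto
  · rintro ⟨hx, rfl⟩
    exact ⟨hx, hi, rfl⟩

/-- If all fibers of `q` and `q'` on `S` have the same positive size, then they have a common
transversal in `S`. -/
theorem exists_common_transversal {α β : Type*} [DecidableEq α] [DecidableEq β] [Fintype β]
    {S : Finset α} {q q' : α → β} {r : ℕ}
    (hq : ∀ i, (S.filter fun x => q x = i).card = r + 1)
    (hq' : ∀ i, (S.filter fun x => q' x = i).card = r + 1) :
    ∃ s : β → α, (∀ i, s i ∈ S) ∧ (∀ i, q (s i) = i) ∧ Function.Bijective (q' ∘ s) := by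
  let t : β → Finset β := fun i => (S.filter fun x => q x = i).image q'
  have hall : ∀ A : Finset β, A.card ≤ (A.biUnion t).card := by
    intro A
    refine Nat.le_of_mul_le_mul_right ?_ r.succ_pos
    rw [← card_filter_mem hq, ← card_filter_mem hq']
    refine Finset.card_le_card fun x hx => ?_
    simp only [Finset.mem_filter] at hx
    simp only [t, Finset.mem_filter, Finset.mem_biUnion, Finset.mem_image]
    exact ⟨hx.1, q x, hx.2, x, ⟨hx.1, rfl⟩, rfl⟩
  obtain ⟨f, hf, hft⟩ := (Finset.all_card_le_biUnion_card_iff_exists_injective t).1 hall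
  simp only [t, Finset.mem_image, Finset.mem_filter] at hft
  choose s hs using hft
  have : q' ∘ s = f := funext fun i => (hs i).2
  exact ⟨s, fun i => (hs i).1.1, fun i => (hs i).1.2, this ▸ Finite.injective_iff_bijective.1 hf⟩

/-- Two maps with all fibers of size 3 have three disjoint common transversals. -/
theorem exists_three_transversals {m : ℕ} {q q' : Fin m → Fin 6}
    (hq : ∀ i, fiberCard q i = 3) (hq' : ∀ i, fiberCard q' i = 3) :
    ∃ (u v w : Fin 6 → Fin m) (P Q R : Equiv.Perm (Fin 6)),
      (∀ i, q (u i) = i) ∧ (∀ i, q (v i) = i) ∧ (∀ i, q (w i) = i) ∧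
      (∀ i, q' (u i) = P i) ∧ (∀ i, q' (v i) = Q i) ∧ (∀ i, q' (w i) = R i) ∧
      (∀ i j, u i ≠ v j) ∧ (∀ i j, u i ≠ w j) ∧ (∀ i j, v i ≠ w j) ∧
      ∀ x, (∃ i, u i = x) ∨ (∃ i, v i = x) ∨ ∃ i, w i = x := by
  obtain ⟨u, huS, hu, hu'⟩ := exists_common_transversal hq hq'
  have hqu := card_filter_sdiff_image huS ⟨fun i j h => by simpa [hu] using h,
    fun i => ⟨i, hu i⟩⟩ hq
  have hqu' := card_filter_sdiff_image huS hu' hq'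
  obtain ⟨v, hvS, hv, hv'⟩ := exists_common_transversal hqu hqu'
  have hqv := card_filter_sdiff_image hvS ⟨fun i j h => by simpa [hv] using h,
    fun i => ⟨i, hv i⟩⟩ hqu
  have hqv' := card_filter_sdiff_image hvS hv' hqu'
  obtain ⟨w, hwS, hw, hw'⟩ := exists_common_transversal hqv hqv'
  have hqw := card_filter_sdiff_image hwS ⟨fun i j h => by simpa [hw] using h,
    fun i => ⟨i, hw i⟩⟩ hqv
  simp only [Finset.mem_sdiff, Finset.mem_image, Finset.mem_univ, true_and, not_exists]
    at hvS hwS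
  refine ⟨u, v, w, Equiv.ofBijective _ hu', Equiv.ofBijective _ hv', Equiv.ofBijective _ hw',
    hu, hv, hw, fun _ => rfl, fun _ => rfl, fun _ => rfl, fun i j => hvS j i,
    fun i j => (hwS j).1 i, fun i j => (hwS j).2 i, fun x => ?_⟩
  by_contra hx
  simp only [not_or, not_exists] at hx
  have := hqw (q x)
  rw [Finset.card_eq_zero] at this
  refine Finset.eq_empty_iff_forall_notMem.1 this x ?_
  simp [hx]

/-- Any two maps to `Fin 6` with all fibers of size 3 are joined by five cycles. -/
theorem exists_cycle_decomposition {m : ℕ} {q q' : Fin m → Fin 6}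
    (hq : ∀ i, fiberCard q i = 3) (hq' : ∀ i, fiberCard q' i = 3) :
    ∃ L : List (Equiv.Perm (Fin m)),
      L.length ≤ 5 ∧ (∀ σ ∈ L, IsPCycle q σ) ∧ q' = q ∘ ⇑L.prod := by
  obtain ⟨u, v, w, P, Q, R, hu, hv, hw, hP, hQ, hR, huv, huw, hvw, hcover⟩ :=
    exists_three_transversals hq hq'
  obtain ⟨σ₁, σ₂, σ₃, h₁, h₂, h₃, hσu, hσv, hσ⟩ := (pairSolvable P Q).exists_pCycles hu hv huv
  obtain ⟨C, T, hC, hT, rfl⟩ := exists_isOneCycle_mul R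
  let s : Fin 6 ↪ Fin m := ⟨w, fun i j h => by rw [← hw i, ← hw j, h]⟩
  have hsw : ∀ i, s i = w i := fun _ => rfl
  refine ⟨[σ₁, σ₂, σ₃, C.viaEmbedding s, T.viaEmbedding s], le_rfl, ?_, ?_⟩
  · simpa [h₁, h₂, h₃] using ⟨hC.isPCycle_viaEmbedding hw, hT.isPCycle_viaEmbedding hw⟩
  have hoff : ∀ (D : Equiv.Perm (Fin 6)) x, (∀ i, w i ≠ x) → D.viaEmbedding s x = x :=
    fun D x hx => D.viaEmbedding_apply_of_notMem s x fun ⟨i, hi⟩ => hx i hi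
  ext1 x
  simp only [List.prod_cons, List.prod_nil, mul_one, Function.comp_apply, Equiv.Perm.mul_apply]
  obtain ⟨i, rfl⟩ | ⟨i, rfl⟩ | ⟨i, rfl⟩ := hcover x
  · rw [hoff T _ fun j => (huw i j).symm, hoff C _ fun j => (huw i j).symm, hσu, hP]
  · rw [hoff T _ fun j => (hvw i j).symm, hoff C _ fun j => (hvw i j).symm, hσv, hQ]
  · rw [← hsw, Equiv.Perm.viaEmbedding_apply, Equiv.Perm.viaEmbedding_apply, hsw, hsw,
      hσ _ (fun j => huw j _) (fun j => hvw j _), hw, hR, Equiv.Perm.mul_apply]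

/-- The map on classes induced by a `p`-cycle extends to a permutation with at most one
nontrivial cycle. -/
theorem IsPCycle.exists_shadow {m n : ℕ} {p : Fin m → Fin n} {σ : Equiv.Perm (Fin m)}
    (h : IsPCycle p σ) : ∃ C : Equiv.Perm (Fin n), IsOneCycle C ∧
      ∀ x, σ x ≠ x → p (σ x) = C (p x) ∧ C (p x) ≠ p x := by
  classical
  obtain ⟨hb, rfl | hc⟩ := h
  · exact ⟨1, Or.inl rfl, fun x hx => absurd rfl hx⟩
  let τ : Equiv.Perm {x // σ x ≠ x} := σ.subtypePerm fun x => by simp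
  let e : {x // σ x ≠ x} ↪ Fin n := ⟨fun x => p x, fun x y hxy => Subtype.ext (hb x.2 y.2 hxy)⟩
  have hτ : τ.IsCycle := by
    obtain ⟨x, hx, hx'⟩ := hc
    refine ⟨⟨x, hx⟩, fun h => hx (congrArg Subtype.val h), fun y _ => ?_⟩
    exact Equiv.Perm.sameCycle_subtypePerm.2 (hx' y.2)
  have key : ∀ x, σ x ≠ x → p (σ x) = τ.viaEmbedding e (p x) := fun x hx =>
    (τ.viaEmbedding_apply e ⟨x, hx⟩).symm
  refine ⟨τ.viaEmbedding e, Or.inr (@Equiv.Perm.IsCycle.extendDomain _ _ _ _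
    (fun _ => Classical.propDecidable _) (Equiv.ofInjective e e.injective) hτ), fun x hx =>
    ⟨key x hx, fun h => hx (hb (by simpa [psupp] using hx) hx ((key x hx).trans h))⟩⟩

/-- A fixed point free involution of `Fin 6`. -/
def partner : Fin 6 → Fin 6 := ofList [1, 0, 3, 2, 5, 4]

/-- The weight of the step from the class `i` to the class `f i`: moves to the partner count
twice. -/
def stepWeight (f : Fin 6 → Fin 6) (i : Fin 6) : ℕ :=
  if f i = i then 0 else if f i = partner i then 2 else 1

/-- The total weight of a map on classes. -/
def totalWeight (f : Fin 6 → Fin 6) : ℕ :=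
  stepWeight f 0 + stepWeight f 1 + stepWeight f 2 + stepWeight f 3 + stepWeight f 4 +
    stepWeight f 5

theorem totalWeight_eq_sum (f : Fin 6 → Fin 6) : totalWeight f = ∑ i, stepWeight f i := by
  simp only [totalWeight, Fin.sum_univ_six]

/-- The cycles of maximal weight. -/
def heavyCycles : List (List (Fin 6)) :=
  [[1, 2, 3, 4, 5, 0], [1, 2, 3, 5, 0, 4], [1, 3, 4, 2, 5, 0], [1, 3, 5, 2, 0, 4],
    [1, 4, 0, 2, 5, 3], [1, 4, 3, 0, 5, 2], [1, 5, 0, 2, 3, 4], [1, 5, 3, 0, 2, 4],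
    [2, 0, 3, 4, 5, 1], [2, 0, 3, 5, 1, 4], [3, 0, 4, 2, 5, 1], [3, 0, 5, 2, 1, 4],
    [4, 0, 1, 2, 5, 3], [4, 0, 3, 1, 5, 2], [5, 0, 1, 2, 3, 4], [5, 0, 3, 1, 2, 4]]

theorem totalWeight_permutations :
    ((List.permutations' [(0 : Fin 6), 1, 2, 3, 4, 5]).all fun l =>
      totalWeight (ofList l) < 9 || !oneCycleTest (ofList l) ||
        (totalWeight (ofList l) = 9 && heavyCycles.elem l)) = true := by
  decide +kernel

theorem IsOneCycle.totalWeight_lt_or {C : Equiv.Perm (Fin 6)} (hC : IsOneCycle C) :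
    totalWeight C < 9 ∨ totalWeight C = 9 ∧ toList C ∈ heavyCycles := by
  have := List.all_eq_true.1 totalWeight_permutations _ (toList_mem_permutations C)
  simpa [ofList_toList, (oneCycleTest_iff C).2 hC] using this

/-- The step from `i` along `f`, followed by `g`, leads to the partner of `i` in two moves. -/
def Completes (f g : Fin 6 → Fin 6) (i : Fin 6) : Prop :=
  f i ≠ partner i ∧ g (f i) = partner i

instance (f g : Fin 6 → Fin 6) (i : Fin 6) : Decidable (Completes f g i) :=
  inferInstanceAs (Decidable (_ ∧ _))

theorem card_indirect_of_mem_heavyCycles : ∀ a ∈ heavyCycles,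
    (Finset.univ.filter fun i => ofList a i ≠ partner i).card = 3 ∧ ∀ i, ofList a i ≠ i := by
  decide +kernel

theorem completes_unique : ∀ a ∈ heavyCycles, ∀ b ∈ heavyCycles, ∀ i j,
    Completes (ofList a) (ofList b) i → Completes (ofList a) (ofList b) j → i = j := by
  decide +kernel

theorem not_completes_triangle : ∀ a ∈ heavyCycles, ∀ b ∈ heavyCycles,
    (∃ i, Completes (ofList a) (ofList b) i) → ∀ c ∈ heavyCycles,
    (∃ i, Completes (ofList a) (ofList c) i) → ¬ ∃ i, Completes (ofList b) (ofList c) i := by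
  decide +kernel

/-- The weight of the step of the point `z` under `σ`, where `C` is the map on classes. -/
def moveWeight {m : ℕ} (p : Fin m → Fin 6) (C : Fin 6 → Fin 6) (σ : Equiv.Perm (Fin m))
    (z : Fin m) : ℕ :=
  if σ z = z then 0 else stepWeight C (p z)

theorem IsBalanced.sum_moveWeight {m : ℕ} {p : Fin m → Fin 6} {σ : Equiv.Perm (Fin m)}
    (h : IsBalanced p σ) (C : Fin 6 → Fin 6) :
    ∑ z, moveWeight p C σ z =
      ∑ i ∈ (Finset.univ.filter fun z => σ z ≠ z).image p, stepWeight C i := by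
  rw [Finset.sum_image fun x hx y hy hxy => h (by simpa [psupp] using hx)
    (by simpa [psupp] using hy) hxy, Finset.sum_filter]
  simp only [moveWeight, ite_not]

theorem IsBalanced.sum_moveWeight_le {m : ℕ} {p : Fin m → Fin 6} {σ : Equiv.Perm (Fin m)}
    (h : IsBalanced p σ) (C : Fin 6 → Fin 6) : ∑ z, moveWeight p C σ z ≤ totalWeight C := by
  rw [h.sum_moveWeight, totalWeight_eq_sum]
  exact Finset.sum_le_sum_of_subset (Finset.subset_univ _)

theorem IsBalanced.exists_of_sum_moveWeight_eq {m : ℕ} {p : Fin m → Fin 6}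
    {σ : Equiv.Perm (Fin m)} (h : IsBalanced p σ) {C : Fin 6 → Fin 6}
    (heq : ∑ z, moveWeight p C σ z = totalWeight C) {i : Fin 6} (hi : C i ≠ i) :
    ∃ z, σ z ≠ z ∧ p z = i := by
  by_contra hne
  rw [h.sum_moveWeight, totalWeight_eq_sum] at heq
  refine (Finset.sum_lt_sum_of_subset (Finset.subset_univ _) (Finset.mem_univ i) ?_ ?_
    fun _ _ _ => Nat.zero_le _).ne heq
  · simpa using hne
  · rw [stepWeight, if_neg hi]
    split_ifs <;> simp

/-- A path `y` of classes whose steps have the weights `w`: each step stays, or follows `C`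
without reaching the partner, or has weight at least 2. -/
def IsWeightedPath (C : ℕ → Fin 6 → Fin 6) (y : ℕ → Fin 6) (w : ℕ → ℕ) : Prop :=
  ∀ k, w k = 0 ∧ y (k + 1) = y k ∨
    w k = 1 ∧ y (k + 1) = C k (y k) ∧ C k (y k) ≠ partner (y k) ∨ 2 ≤ w k

theorem IsWeightedPath.two_le_sum {C : ℕ → Fin 6 → Fin 6} {y : ℕ → Fin 6} {w : ℕ → ℕ}
    (h : IsWeightedPath C y w) (hend : y 4 = partner (y 0)) :
    2 ≤ w 0 + w 1 + w 2 + w 3 := by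
  have hp : partner (y 0) ≠ y 0 := by
    generalize y 0 = i
    revert i
    decide
  by_contra! hlt
  have h0 := h 0
  have h1 := h 1
  have h2 := h 2
  have h3 := h 3
  clear h
  grind

theorem IsWeightedPath.exists_completes {C : ℕ → Fin 6 → Fin 6} {y : ℕ → Fin 6} {w : ℕ → ℕ}
    (h : IsWeightedPath C y w) (hend : y 4 = partner (y 0)) (hsum : w 0 + w 1 + w 2 + w 3 = 2)
    {j : ℕ} (hj : j < 4) (hw : w j = 1) :
    ∃ k < 4, j < k ∧ Completes (C j) (C k) (y j) ∨
      k < j ∧ ∃ i, C k i = y j ∧ Completes (C k) (C j) i := by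
  obtain ⟨k, hk, hkj, hwk⟩ : ∃ k < 4, k ≠ j ∧ w k = 1 := by
    by_contra! hne
    have h0 := hne 0
    have h1 := hne 1
    have h2 := hne 2
    have h3 := hne 3
    interval_cases j <;> omega
  refine ⟨k, hk, ?_⟩
  have h0 := h 0
  have h1 := h 1
  have h2 := h 2
  have h3 := h 3
  clear h
  unfold Completes
  interval_cases j <;> interval_cases k <;> grind

/-- Among four heavy cycles all of whose indirect steps are completed, an earlier one is
completed by each later one. -/
theorem exists_completes_of_lt {C : ℕ → Equiv.Perm (Fin 6)}
    (hC : ∀ j < 4, toList (C j) ∈ heavyCycles)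
    (h : ∀ j < 4, ∀ i, C j i ≠ partner i → ∃ k < 4, j < k ∧ Completes (C j) (C k) i ∨
      k < j ∧ ∃ i', C k i' = i ∧ Completes (C k) (C j) i')
    {j k : ℕ} (hk : k < 4) (hjk : j < k) : ∃ i, Completes (C j) (C k) i := by
  have hj : j < 4 := hjk.trans hk
  have huniq : ∀ j < 4, ∀ k < 4, ∀ i i', Completes (C j) (C k) i → Completes (C j) (C k) i' →
      i = i' := by
    intro j hj k hk i i'
    simpa only [ofList_toList] using completes_unique _ (hC j hj) _ (hC k hk) i i'
  let A := Finset.univ.filter fun i => C j i ≠ partner i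
  have hA : A.card = 3 := by
    simpa only [ofList_toList] using (card_indirect_of_mem_heavyCycles _ (hC j hj)).1
  choose! κ hκ4 hκ using h j hj
  have hmaps : Set.MapsTo κ A ((Finset.range 4).erase j : Finset ℕ) := by
    intro i hi
    have hi : C j i ≠ partner i := by simpa [A] using hi
    simp only [Finset.coe_erase, Finset.coe_range, Set.mem_sdiff, Set.mem_Iio,
      Set.mem_singleton_iff]
    refine ⟨hκ4 i hi, ?_⟩
    rcases hκ i hi with ⟨h, -⟩ | ⟨h, -⟩ <;> omega
  have hinj : Set.InjOn κ A := by
    intro i hi i' hi' heq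
    have hi : C j i ≠ partner i := by simpa [A] using hi
    have hi' : C j i' ≠ partner i' := by simpa [A] using hi'
    have hκi := hκ i hi
    have hκi' := hκ i' hi'
    rw [← heq] at hκi'
    rcases hκi with ⟨hlt, hc⟩ | ⟨hlt, l, hl, hc⟩ <;>
      rcases hκi' with ⟨hlt', hc'⟩ | ⟨hlt', l', hl', hc'⟩
    · exact huniq j hj _ (hκ4 i hi) i i' hc hc'
    · omega
    · omega
    · exact hl.symm.trans ((congrArg _ (huniq _ (hκ4 i hi) j hj l l' hc hc')).trans hl')
  have hsurj := Finset.surjOn_of_injOn_of_card_le κ hmaps hinj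
    (by rw [hA, Finset.card_erase_of_mem (by simpa using hj)]; simp)
  obtain ⟨i, hi, rfl⟩ := hsurj (show k ∈ (((Finset.range 4).erase j : Finset ℕ) : Set ℕ) by
    simp; omega)
  have hi : C j i ≠ partner i := by simpa [A] using hi
  rcases hκ i hi with ⟨-, hc⟩ | ⟨hlt, -⟩
  · exact ⟨i, hc⟩
  · omega

/-- Pairs of classes of size 3 cannot be exchanged by four cycles. -/
theorem not_exists_four_cycles {p : Fin 18 → Fin 6} {σ : ℕ → Equiv.Perm (Fin 18)}
    (hσ : ∀ k, IsPCycle p (σ k)) :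
    ¬ ∀ x, p (σ 3 (σ 2 (σ 1 (σ 0 x)))) = partner (p x) := by
  intro hend
  choose C hC hCσ using fun k => (hσ k).exists_shadow
  let Z : ℕ → Equiv.Perm (Fin 18) := fun k => k.rec 1 fun k τ => σ k * τ
  let y : Fin 18 → ℕ → Fin 6 := fun x k => p (Z k x)
  let w : Fin 18 → ℕ → ℕ := fun x k => moveWeight p (C k) (σ k) (Z k x)
  have hpath : ∀ x, IsWeightedPath (fun k => C k) (y x) (w x) := by
    intro x k
    have hy : y x (k + 1) = p (σ k (Z k x)) := rfl
    by_cases hm : σ k (Z k x) = Z k x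
    · exact Or.inl ⟨if_pos hm, by rw [hy, hm]⟩
    · obtain ⟨h₁, h₂⟩ := hCσ k _ hm
      have hw : w x k = if C k (y x k) = partner (y x k) then 2 else 1 := by
        simp only [w, moveWeight, if_neg hm, stepWeight]
        exact if_neg h₂
      split_ifs at hw with h₃
      · exact Or.inr (Or.inr hw.ge)
      · exact Or.inr (Or.inl ⟨hw, hy.trans h₁, h₃⟩)
  have hy4 : ∀ x, y x 4 = partner (y x 0) := hend
  have hsumw : ∀ k, ∑ x, w x k = ∑ z, moveWeight p (C k) (σ k) z := fun k =>
    Equiv.sum_comp (Z k) fun z => moveWeight p (C k) (σ k) z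
  have hle : ∀ k, ∑ z, moveWeight p (C k) (σ k) z ≤ totalWeight (C k) := fun k =>
    (hσ k).1.sum_moveWeight_le _
  have hnine : ∀ k, totalWeight (C k) ≤ 9 := fun k => by
    rcases (hC k).totalWeight_lt_or with h | h
    · exact h.le
    · exact h.1.le
  have htotal : ∑ x, (w x 0 + w x 1 + w x 2 + w x 3) = ∑ x, w x 0 + ∑ x, w x 1 + ∑ x, w x 2 +
      ∑ x, w x 3 := by simp only [Finset.sum_add_distrib]
  have htwo : ∀ x, 2 ≤ w x 0 + w x 1 + w x 2 + w x 3 := fun x => (hpath x).two_le_sum (hy4 x)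
  have hge : 36 ≤ ∑ x, (w x 0 + w x 1 + w x 2 + w x 3) := by
    simpa using Finset.card_nsmul_le_sum Finset.univ _ 2 fun x _ => htwo x
  simp only [hsumw] at htotal
  have heq : ∀ k < 4, ∑ z, moveWeight p (C k) (σ k) z = totalWeight (C k) ∧
      totalWeight (C k) = 9 := by
    have h0 := hle 0
    have h1 := hle 1
    have h2 := hle 2
    have h3 := hle 3
    have h0' := hnine 0
    have h1' := hnine 1
    have h2' := hnine 2
    have h3' := hnine 3
    intro k hk
    interval_cases k <;> omega
  have hheavy : ∀ k < 4, toList (C k) ∈ heavyCycles := fun k hk =>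
    ((hC k).totalWeight_lt_or.resolve_left (heq k hk).2.not_lt).2
  have hitem : ∀ x, w x 0 + w x 1 + w x 2 + w x 3 = 2 := by
    have hsum2 : ∑ x : Fin 18, 2 = ∑ x, (w x 0 + w x 1 + w x 2 + w x 3) := by
      have h0 := heq 0 (by decide)
      have h1 := heq 1 (by decide)
      have h2 := heq 2 (by decide)
      have h3 := heq 3 (by decide)
      simp only [Finset.sum_const, Finset.card_univ, Fintype.card_fin, smul_eq_mul]
      omega
    exact fun x => ((Finset.sum_eq_sum_iff_of_le fun x _ => htwo x).1 hsum2 x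
      (Finset.mem_univ x)).symm
  have hcompl := @exists_completes_of_lt C hheavy fun j hj i hi => by
    have hne : C j i ≠ i := by
      simpa only [ofList_toList] using (card_indirect_of_mem_heavyCycles _ (hheavy j hj)).2 i
    obtain ⟨z, hz, rfl⟩ := (hσ j).1.exists_of_sum_moveWeight_eq (heq j hj).1 hne
    obtain ⟨x, rfl⟩ := (Z j).surjective z
    refine (hpath x).exists_completes (hy4 x) (hitem x) hj ?_
    simp only [w, moveWeight, if_neg hz, stepWeight, if_neg hne, if_neg hi]
  have := not_completes_triangle _ (hheavy 0 (by decide)) _ (hheavy 1 (by decide))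
    (by simpa only [ofList_toList] using hcompl (j := 0) (k := 1) (by decide) (by decide))
    _ (hheavy 2 (by decide))
    (by simpa only [ofList_toList] using hcompl (j := 0) (k := 2) (by decide) (by decide))
  simp only [ofList_toList] at this
  exact this (hcompl (j := 1) (k := 2) (by decide) (by decide))

/-- The diameter of the partition polytope `PP(3,3,3,3,3,3)` equals 5: every
pair of `(18,6)`-partitions with all fibers of size 3 admits a cycle
decomposition of length at most 5, and some pair admits none of length at
most 4. -/
theorem partition_polytope_333333_diameter_eq_five :
    (∀ q q' : Fin 18 → Fin 6,
      (∀ i, fiberCard q i = 3) → (∀ i, fiberCard q' i = 3) →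
      ∃ L : List (Equiv.Perm (Fin 18)),
        L.length ≤ 5 ∧ (∀ σ ∈ L, IsPCycle q σ) ∧ q' = q ∘ ⇑L.prod) ∧
    (∃ p p' : Fin 18 → Fin 6,
      (∀ i, fiberCard p i = 3) ∧ (∀ i, fiberCard p' i = 3) ∧
      ∀ L : List (Equiv.Perm (Fin 18)),
        (∀ σ ∈ L, IsPCycle p σ) → p' = p ∘ ⇑L.prod → 4 < L.length) := by
  refine ⟨fun q q' hq hq' => exists_cycle_decomposition hq hq',
    fun x => Fin.ofNat 6 (x / 3), fun x => partner (Fin.ofNat 6 (x / 3)), by decide, by decide,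
    fun L hL hp => ?_⟩
  by_contra! hlen
  have hmem : ∀ k, IsPCycle _ (L.reverse.getD k 1) := fun k => by
    rcases lt_or_ge k L.reverse.length with hk | hk
    · rw [List.getD_eq_getElem _ _ hk]
      exact hL _ (List.mem_reverse.1 (List.getElem_mem hk))
    · rw [List.getD_eq_default _ _ hk]
      exact ⟨fun x hx => absurd rfl hx, Or.inl rfl⟩
  refine not_exists_four_cycles hmem fun x => ?_
  rw [congrFun hp x]
  match L, hlen with
  | [], _ => rfl
  | [_], _ => rfl
  | [_, _], _ => rfl
  | [_, _, _], _ => rfl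
  | [_, _, _, _], _ => rfl
end

section
/- Let G be a simple graph on a finite vertex type α in which every vertex has even degree and whose maximum degree equals 4. Then G admits a path odd-cover of size at most 3: there exists a family of at most three paths in the complete graph on α whose symmetric difference equals G. -/
/-- The degree of a vertex, as the cardinality of its neighbor set. -/
noncomputable def degS {α : Type*} (G : SimpleGraph α) (v : α) : ℕ := (G.neighborSet v).ncard

/-- A polycycle: every vertex has degree 0 or 2 (every component is a cycle). -/
def IsPolycycle {α : Type*} (G : SimpleGraph α) : Prop :=
  ∀ v, degS G v = 0 ∨ degS G v = 2

/-- A cycle graph: a nonempty connected graph in which every non-isolated vertex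
has degree 2. -/
def IsCycleGraph {α : Type*} (G : SimpleGraph α) : Prop :=
  G ≠ ⊥ ∧ (∀ v, degS G v = 0 ∨ degS G v = 2) ∧
    ∀ u v, 0 < degS G u → 0 < degS G v → G.Reachable u v

/-- A path graph: a graph whose edge set forms a nontrivial path. -/
def IsPathGraph {α : Type*} (G : SimpleGraph α) : Prop :=
  G ≠ ⊥ ∧ G.IsAcyclic ∧ (∀ v, degS G v ≤ 2) ∧
    ∀ u v, 0 < degS G u → 0 < degS G v → G.Reachable u v

/-- A linear forest: an acyclic graph of maximum degree at most 2. -/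
def IsLinearForest {α : Type*} (G : SimpleGraph α) : Prop :=
  G.IsAcyclic ∧ ∀ v, degS G v ≤ 2

/-- The symmetric difference of a family (list) of graphs: an edge belongs to it
iff it belongs to an odd number of members. -/
def listSymmDiff {α : Type*} (L : List (SimpleGraph α)) : SimpleGraph α :=
  L.foldr symmDiff ⊥

open SimpleGraph

section Degree

variable {α : Type*} {F H : SimpleGraph α} {x y z : α}

lemma exists_adj_ne_of_two_le_degS (h : 2 ≤ degS F x) (w : α) : ∃ y, F.Adj x y ∧ y ≠ w := by
  obtain ⟨y, hy, hne⟩ := Set.exists_ne_of_one_lt_ncard (s := F.neighborSet x) h w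
  exact ⟨y, hy, hne⟩

lemma degS_edge_left (h : x ≠ y) : degS (edge x y) x = 1 := by
  rw [degS, Set.ncard_eq_one]
  refine ⟨y, ?_⟩
  ext a
  simp only [mem_neighborSet, edge_adj, Set.mem_singleton_iff]
  grind

lemma degS_edge_right (h : x ≠ y) : degS (edge x y) y = 1 := by
  rw [edge_comm, degS_edge_left h.symm]

variable [Finite α]

lemma degS_mono (h : F ≤ H) (x : α) : degS F x ≤ degS H x :=
  Set.ncard_le_ncard (fun _ hy => h hy) (Set.toFinite _)

lemma degS_pos (h : F.Adj x y) : 0 < degS F x :=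
  (Set.ncard_pos (Set.toFinite _)).2 ⟨y, h⟩

lemma exists_adj_of_degS_pos (h : 0 < degS F x) : ∃ y, F.Adj x y :=
  (Set.ncard_pos (Set.toFinite _)).1 h

lemma two_le_degS (hy : F.Adj x y) (hz : F.Adj x z) (h : y ≠ z) : 2 ≤ degS F x := by
  rw [← Set.ncard_pair h]
  exact Set.ncard_le_ncard (by rintro a (rfl | rfl) <;> assumption) (Set.toFinite _)

lemma eq_of_degS_le_one (h : degS F x ≤ 1) (hy : F.Adj x y) (hz : F.Adj x z) : y = z := by
  by_contra hne
  have := two_le_degS hy hz hne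
  omega

lemma degS_sup_of_disjoint (h : Disjoint F H) (x : α) :
    degS (F ⊔ H) x = degS F x + degS H x := by
  have hd : Disjoint (F.neighborSet x) (H.neighborSet x) :=
    Set.disjoint_left.2 fun y h₁ h₂ => (disjoint_left.1 h) x y h₁ h₂
  rw [degS, degS, degS, ← Set.ncard_union_eq hd (Set.toFinite _) (Set.toFinite _)]
  rfl

lemma degS_edge_of_ne (hx : z ≠ x) (hy : z ≠ y) : degS (edge x y) z = 0 := by
  rw [degS, Set.ncard_eq_zero (Set.toFinite _)]
  ext a
  simp only [mem_neighborSet, edge_adj, Set.mem_empty_iff_false]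
  grind

lemma degS_edge_le_one (x y z : α) : degS (edge x y) z ≤ 1 := by
  by_contra! h
  obtain ⟨a, b, ha, hb, hab⟩ := (Set.one_lt_ncard_iff (Set.toFinite _)).1 h
  simp only [mem_neighborSet, edge_adj] at ha hb
  grind

lemma degS_sdiff_edge_add (h : F.Adj x y) (z : α) :
    degS (F \ edge x y) z + degS (edge x y) z = degS F z := by
  rw [← degS_sup_of_disjoint disjoint_sdiff_self_left, sdiff_sup_cancel]
  simpa [edge_le_iff] using Or.inr h

lemma Set.odd_ncard_symmDiff (s t : Set α) :
    Odd (symmDiff s t).ncard ↔ ¬(Odd s.ncard ↔ Odd t.ncard) := by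
  have h₁ := Set.ncard_inter_add_ncard_sdiff_eq_ncard s t (Set.toFinite _)
  have h₂ := Set.ncard_inter_add_ncard_sdiff_eq_ncard t s (Set.toFinite _)
  have h₃ : (symmDiff s t).ncard = (s \ t).ncard + (t \ s).ncard :=
    Set.ncard_union_eq disjoint_sdiff_sdiff (Set.toFinite _) (Set.toFinite _)
  rw [Set.inter_comm] at h₂
  rw [h₃, ← h₁, ← h₂]
  simp only [Nat.odd_iff]
  omega

lemma odd_degS_symmDiff (F H : SimpleGraph α) (x : α) :
    Odd (degS (symmDiff F H) x) ↔ ¬(Odd (degS F x) ↔ Odd (degS H x)) := by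
  rw [degS, degS, degS, ← Set.odd_ncard_symmDiff]
  rfl

lemma even_ncard_odd_degS (F : SimpleGraph α) : Even {x | Odd (degS F x)}.ncard := by
  classical
  cases nonempty_fintype α
  convert F.even_card_odd_degree_vertices
  rw [← Set.ncard_coe_finset]
  congr 1
  ext x
  simp [degS, Set.ncard_eq_toFinset_card', SimpleGraph.degree, neighborFinset]

end Degree

section LinearForest

variable {α : Type*} {F H : SimpleGraph α} {x y z : α}

/-- A graph with a cycle has a nonempty set of vertices in which every vertex has two neighbors. -/
lemma exists_core_of_not_isAcyclic (h : ¬F.IsAcyclic) :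
    ∃ K : Set α, K.Nonempty ∧
      ∀ x ∈ K, ∃ y ∈ K, ∃ z ∈ K, y ≠ z ∧ F.Adj x y ∧ F.Adj x z := by
  simp only [IsAcyclic, not_forall, not_not] at h
  obtain ⟨u, c, hc⟩ := h
  refine ⟨c.toSubgraph.verts, ⟨u, c.start_mem_verts_toSubgraph⟩, fun x hx => ?_⟩
  obtain ⟨y, z, hyz, hs⟩ := Set.ncard_eq_two.1
    (hc.ncard_neighborSet_toSubgraph_eq_two (c.mem_verts_toSubgraph.1 hx))
  have hy : c.toSubgraph.Adj x y := by
    rw [← Subgraph.mem_neighborSet, hs]; simp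
  have hz : c.toSubgraph.Adj x z := by
    rw [← Subgraph.mem_neighborSet, hs]; simp
  exact ⟨y, hy.snd_mem, z, hz.snd_mem, hyz, hy.adj_sub, hz.adj_sub⟩

lemma not_adj_of_not_reachable (h : ¬F.Reachable x y) : ¬F.Adj x y := fun ha => h ha.reachable

variable [Finite α]

lemma isAcyclic_of_degS_le_one (h : ∀ x, degS F x ≤ 1) : F.IsAcyclic := by
  by_contra hF
  obtain ⟨K, ⟨x, hx⟩, hK⟩ := exists_core_of_not_isAcyclic hF
  obtain ⟨y, -, z, -, hyz, hy, hz⟩ := hK x hx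
  exact hyz (eq_of_degS_le_one (h x) hy hz)

/-- In an acyclic graph, a leaf other than `u` can be reached from every nonisolated `u`. -/
lemma SimpleGraph.IsAcyclic.exists_reachable_degS_eq_one (hF : F.IsAcyclic) {u : α}
    (hu : 0 < degS F u) : ∃ w, w ≠ u ∧ F.Reachable u w ∧ degS F w = 1 := by
  classical
  cases nonempty_fintype α
  let P : ℕ → Prop := fun n => ∃ w, ∃ p : F.Walk u w, p.IsPath ∧ p.length = n
  obtain ⟨y, hy⟩ := exists_adj_of_degS_pos hu
  have hP1 : P 1 := ⟨y, Walk.cons hy Walk.nil, by simp [hy.ne], rfl⟩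
  have hb : ∀ n, P n → n ≤ Fintype.card α := by
    rintro n ⟨w, p, hp, rfl⟩
    exact hp.length_lt.le
  obtain ⟨w, p, hp, hn⟩ : P (Nat.findGreatest P (Fintype.card α)) :=
    Nat.findGreatest_spec (hb 1 hP1) hP1
  have hmax : ∀ n, P n → n ≤ p.length := fun n h => hn ▸ Nat.le_findGreatest (hb n h) h
  have h1 := hmax 1 hP1
  have hw : ∀ z, F.Adj w z → z = p.penultimate := by
    intro z hz
    refine hF.eq_penultimate_of_adj_end hp hz ?_
    by_contra hns
    have := hmax _ ⟨z, p.concat hz, hp.concat hns hz, rfl⟩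
    simp at this
  refine ⟨w, ?_, ⟨p⟩, ?_⟩
  · rintro rfl
    rw [Walk.isPath_iff_nil, ← Walk.length_eq_zero_iff] at hp
    omega
  · rw [degS, Set.ncard_eq_one]
    refine ⟨p.penultimate, Set.eq_singleton_iff_unique_mem.2 ⟨?_, hw⟩⟩
    exact (p.adj_penultimate (Walk.not_nil_iff_lt_length.2 h1)).symm

/-- A component of a graph of maximum degree two has at most two vertices of degree at most one. -/
lemma not_reachable_of_degS_le_one (hF : ∀ a, degS F a ≤ 2) (hx : degS F x ≤ 1)
    (hy : degS F y ≤ 1) (hz : degS F z ≤ 1) (hxy : x ≠ y) (hxz : x ≠ z) (hyz : y ≠ z)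
    (h : F.Reachable x y) : ¬F.Reachable x z := by
  classical
  obtain ⟨p, hp⟩ := h.exists_isPath
  have hpn : ¬p.Nil := fun h => hxy h.eq
  have hnb : ∀ a ∈ p.support, F.neighborSet a = p.toSubgraph.neighborSet a ∧
      (a ≠ x → a ≠ y → 2 ≤ degS F a) := by
    intro a ha
    have hsub : p.toSubgraph.neighborSet a ⊆ F.neighborSet a := fun b hb => hb.adj_sub
    suffices h : (F.neighborSet a).ncard ≤ (p.toSubgraph.neighborSet a).ncard ∧
        (a ≠ x → a ≠ y → 2 ≤ degS F a) from
      ⟨(Set.eq_of_subset_of_ncard_le hsub h.1 (Set.toFinite _)).symm, h.2⟩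
    obtain ⟨i, rfl, hi⟩ := Walk.mem_support_iff_exists_getVert.1 ha
    by_cases h0 : i = 0
    · subst h0
      rw [p.getVert_zero, hp.neighborSet_toSubgraph_startpoint hpn, Set.ncard_singleton]
      exact ⟨hx, fun h => absurd rfl h⟩
    by_cases hl : i = p.length
    · subst hl
      rw [p.getVert_length, hp.neighborSet_toSubgraph_endpoint hpn, Set.ncard_singleton]
      exact ⟨hy, fun _ h => absurd rfl h⟩
    have h2 := hp.ncard_neighborSet_toSubgraph_internal_eq_two h0 (lt_of_le_of_ne hi hl)
    exact ⟨h2 ▸ hF _, fun _ _ => h2 ▸ Set.ncard_le_ncard hsub (Set.toFinite _)⟩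
  have hclosed : ∀ b, F.Reachable x b → b ∈ p.support := by
    rintro b ⟨q⟩
    induction q using Walk.concatRec with
    | Hnil => exact p.start_mem_support
    | Hconcat q hab ih =>
      have hc := (hnb _ (ih hx hxy hxz h p hp hpn hnb)).1
      have hmem : p.toSubgraph.Adj _ _ := hc.subset hab
      exact p.mem_verts_toSubgraph.1 hmem.snd_mem
  intro hr
  have := (hnb z (hclosed z hr)).2 hxz.symm hyz.symm
  omega

lemma not_reachable_of_degS_eq_zero (hx : degS F x = 0) (h : x ≠ y) : ¬F.Reachable x y := by
  rintro ⟨p⟩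
  cases p with
  | nil => exact h rfl
  | cons hadj _ => exact (degS_pos hadj).ne' hx

lemma IsLinearForest.mono (hH : IsLinearForest H) (h : F ≤ H) : IsLinearForest F :=
  ⟨hH.1.anti h, fun x => (degS_mono h x).trans (hH.2 x)⟩

lemma IsLinearForest.sup_edge (hF : IsLinearForest F) (hx : degS F x ≤ 1) (hy : degS F y ≤ 1)
    (h : ¬F.Reachable x y) : IsLinearForest (F ⊔ edge x y) := by
  refine ⟨hF.1.sup_edge_of_not_reachable h, fun a => ?_⟩
  rw [degS_sup_of_disjoint ((disjoint_edge _).2 (not_adj_of_not_reachable h))]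
  have h₁ := degS_edge_le_one x y a
  have h₂ := hF.2 a
  by_cases hax : a = x
  · subst hax; omega
  by_cases hay : a = y
  · subst hay; omega
  rw [degS_edge_of_ne hax hay]
  omega

/-- A linear forest with exactly two leaves is a path. -/
lemma IsLinearForest.isPathGraph (hF : IsLinearForest F)
    (h : {x | Odd (degS F x)}.ncard = 2) : IsPathGraph F := by
  obtain ⟨x, y, hxy, hs⟩ := Set.ncard_eq_two.1 h
  have hodd : ∀ a, degS F a = 1 → a = x ∨ a = y := fun a ha => by
    have : a ∈ {x | Odd (degS F x)} := by simp [ha]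
    rwa [hs] at this
  have hx : 0 < degS F x := by
    have : x ∈ {x | Odd (degS F x)} := by simp [hs]
    exact Odd.pos this
  have hxy : F.Reachable x y := by
    obtain ⟨w, hwx, hr, hw⟩ := hF.1.exists_reachable_degS_eq_one hx
    rcases hodd w hw with rfl | rfl
    · exact absurd rfl hwx
    · exact hr
  have hall : ∀ u, 0 < degS F u → F.Reachable x u := by
    intro u hu
    obtain ⟨w, -, hr, hw⟩ := hF.1.exists_reachable_degS_eq_one hu
    rcases hodd w hw with rfl | rfl
    · exact hr.symm
    · exact hxy.trans hr.symm
  refine ⟨?_, hF.1, hF.2, fun u v hu hv => (hall u hu).symm.trans (hall v hv)⟩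
  rintro rfl
  obtain ⟨a, ha⟩ := exists_adj_of_degS_pos hx
  exact ha

end LinearForest

/-- The vertices of odd degree in both graphs. -/
def commonOdd {α : Type*} (F H : SimpleGraph α) : Set α :=
  {x | Odd (degS F x) ∧ Odd (degS H x)}

section Merging

variable {α : Type*} {F H : SimpleGraph α}

lemma commonOdd_comm (F H : SimpleGraph α) : commonOdd F H = commonOdd H F :=
  Set.ext fun _ => and_comm

lemma IsLinearForest.degS_eq_one (hF : IsLinearForest F) {x : α} (hx : Odd (degS F x)) :
    degS F x = 1 := by
  have := hF.2 x
  interval_cases h : degS F x <;> simp_all +decide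

variable [Finite α]

lemma exists_pair_not_reachable (hF : IsLinearForest F) (hH : IsLinearForest H)
    (h : 2 < (commonOdd F H).ncard) : ∃ x ∈ commonOdd F H, ∃ y ∈ commonOdd F H,
      x ≠ y ∧ ¬F.Reachable x y ∧ ¬H.Reachable x y := by
  obtain ⟨a, b, c, ha, hb, hc, hab, hac, hbc⟩ := (Set.two_lt_ncard_iff (Set.toFinite _)).1 h
  have key : ∀ {K : SimpleGraph α}, IsLinearForest K → Odd (degS K a) → Odd (degS K b) →
      Odd (degS K c) → (K.Reachable a b → ¬K.Reachable a c) ∧ (K.Reachable a b → ¬K.Reachable b c) ∧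
        (K.Reachable a c → ¬K.Reachable b c) := by
    intro K hK h₁ h₂ h₃
    have h₁ := (hK.degS_eq_one h₁).le
    have h₂ := (hK.degS_eq_one h₂).le
    have h₃ := (hK.degS_eq_one h₃).le
    exact ⟨not_reachable_of_degS_le_one hK.2 h₁ h₂ h₃ hab hac hbc,
      fun h => not_reachable_of_degS_le_one hK.2 h₂ h₁ h₃ hab.symm hbc hac h.symm,
      fun h h' => not_reachable_of_degS_le_one hK.2 h₃ h₁ h₂ hac.symm hbc.symm hab h.symm h'.symm⟩
  have h₁ := key hF ha.1 hb.1 hc.1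
  have h₂ := key hH ha.2 hb.2 hc.2
  by_contra! hcon
  have h₃ := hcon a ha b hb hab
  have h₄ := hcon a ha c hc hac
  have h₅ := hcon b hb c hc hbc
  tauto

/-- Joining leaves common to two linear forests by edges added to both of them, one is left with
a single common leaf if their number was odd. -/
lemma exists_merge (hF : IsLinearForest F) (hH : IsLinearForest H)
    (h : Odd (commonOdd F H).ncard) : ∃ F' H', IsLinearForest F' ∧ IsLinearForest H' ∧
      symmDiff F' H' = symmDiff F H ∧ (commonOdd F' H').ncard = 1 ∧
      ∀ x, (Odd (degS F' x) ∧ ¬Odd (degS H' x) ↔ Odd (degS F x) ∧ ¬Odd (degS H x)) ∧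
        (¬Odd (degS F' x) ∧ Odd (degS H' x) ↔ ¬Odd (degS F x) ∧ Odd (degS H x)) := by
  induction hn : (commonOdd F H).ncard using Nat.strong_induction_on generalizing F H with
  | _ n ih =>
    subst hn
    by_cases h1 : (commonOdd F H).ncard = 1
    · exact ⟨F, H, hF, hH, rfl, h1, fun _ => ⟨Iff.rfl, Iff.rfl⟩⟩
    have h2 : 2 < (commonOdd F H).ncard := by
      obtain ⟨k, hk⟩ := h
      omega
    obtain ⟨x, hx, y, hy, hxy, hFr, hHr⟩ := exists_pair_not_reachable hF hH h2
    have hFd := (disjoint_edge F).2 (not_adj_of_not_reachable hFr)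
    have hHd := (disjoint_edge H).2 (not_adj_of_not_reachable hHr)
    have hF' := hF.sup_edge (hF.degS_eq_one hx.1).le (hF.degS_eq_one hy.1).le hFr
    have hH' := hH.sup_edge (hH.degS_eq_one hx.2).le (hH.degS_eq_one hy.2).le hHr
    have hsd : symmDiff (F ⊔ edge x y) (H ⊔ edge x y) = symmDiff F H := by
      rw [← hFd.symmDiff_eq_sup, ← hHd.symmDiff_eq_sup, symmDiff_symmDiff_symmDiff_comm,
        symmDiff_self, symmDiff_bot]
    have hdeg : ∀ z, z ≠ x → z ≠ y →
        degS (F ⊔ edge x y) z = degS F z ∧ degS (H ⊔ edge x y) z = degS H z := by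
      intro z hzx hzy
      rw [degS_sup_of_disjoint hFd, degS_sup_of_disjoint hHd, degS_edge_of_ne hzx hzy]
      simp
    have heven : ∀ z, z = x ∨ z = y →
        degS (F ⊔ edge x y) z = 2 ∧ degS (H ⊔ edge x y) z = 2 := by
      rintro z hz
      rw [degS_sup_of_disjoint hFd, degS_sup_of_disjoint hHd]
      rcases hz with rfl | rfl
      · rw [degS_edge_left hxy, hF.degS_eq_one hx.1, hH.degS_eq_one hx.2]
        simp
      · rw [degS_edge_right hxy, hF.degS_eq_one hy.1, hH.degS_eq_one hy.2]
        simp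
    have hset : commonOdd (F ⊔ edge x y) (H ⊔ edge x y) = commonOdd F H \ {x, y} := by
      ext z
      by_cases hz : z = x ∨ z = y
      · simp [commonOdd, heven z hz, hz]
      · simp only [not_or] at hz
        simp [commonOdd, hdeg z hz.1 hz.2, hz]
    have hcard : (commonOdd (F ⊔ edge x y) (H ⊔ edge x y)).ncard + 2 = (commonOdd F H).ncard := by
      rw [hset, ← Set.ncard_pair hxy]
      exact Set.ncard_sdiff_add_ncard_of_subset (by rintro z (rfl | rfl) <;> assumption)
        (Set.toFinite _)
    obtain ⟨F', H', h₁, h₂, h₃, h₄, h₅⟩ := ih _ (by omega) hF' hH'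
      (by rw [← hcard] at h; simpa [Nat.odd_add, parity_simps] using h) rfl
    refine ⟨F', H', h₁, h₂, h₃.trans hsd, h₄, fun z => ?_⟩
    rw [(h₅ z).1, (h₅ z).2]
    by_cases hz : z = x ∨ z = y
    · have : z ∈ commonOdd F H := by rcases hz with rfl | rfl <;> assumption
      have h₁ := this.1
      have h₂ := this.2
      simp [heven z hz, h₁, h₂]
    · simp only [not_or] at hz
      simp [hdeg z hz.1 hz.2]

section Triple

variable {G P Q R : SimpleGraph α}

lemma odd_degS_iff_of_symmDiff_eq (hG : ∀ x, Even (degS G x))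
    (h : symmDiff P (symmDiff Q R) = G) (x : α) :
    Odd (degS R x) ↔ ¬(Odd (degS P x) ↔ Odd (degS Q x)) := by
  have := hG x
  rw [← h, ← Nat.not_odd_iff_even, odd_degS_symmDiff, odd_degS_symmDiff] at this
  tauto

lemma ncard_odd_degS_eq (hG : ∀ x, Even (degS G x)) (h : symmDiff P (symmDiff Q R) = G) :
    {x | Odd (degS P x)}.ncard = (commonOdd P Q).ncard + (commonOdd P R).ncard := by
  have hR := odd_degS_iff_of_symmDiff_eq hG h
  rw [← Set.ncard_union_eq _ (Set.toFinite _) (Set.toFinite _)]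
  · congr 1
    ext x
    simp only [commonOdd, Set.mem_union, Set.mem_ofPred_eq, hR]
    tauto
  · refine Set.disjoint_left.2 fun x h₁ h₂ => ?_
    simp only [commonOdd, Set.mem_ofPred_eq, hR] at h₁ h₂
    tauto

lemma odd_ncard_commonOdd (hG : ∀ x, Even (degS G x)) (h : symmDiff P (symmDiff Q R) = G)
    (hodd : Odd (commonOdd P Q).ncard) : Odd (commonOdd P R).ncard := by
  have := even_ncard_odd_degS P
  rw [ncard_odd_degS_eq hG h] at this
  simp only [Nat.odd_iff, Nat.even_iff] at *
  omega

lemma exists_merge_of_symmDiff_eq (hG : ∀ x, Even (degS G x))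
    (h : symmDiff P (symmDiff Q R) = G) (hP : IsLinearForest P) (hQ : IsLinearForest Q)
    (hodd : Odd (commonOdd P Q).ncard) : ∃ P' Q', IsLinearForest P' ∧ IsLinearForest Q' ∧
      symmDiff P' (symmDiff Q' R) = G ∧ (commonOdd P' Q').ncard = 1 ∧
      commonOdd P' R = commonOdd P R ∧ commonOdd Q' R = commonOdd Q R := by
  obtain ⟨P', Q', hP', hQ', hs, h1, hx⟩ := exists_merge hP hQ hodd
  have h' : symmDiff P' (symmDiff Q' R) = G := by
    rw [← symmDiff_assoc, hs, symmDiff_assoc, h]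
  have hR := odd_degS_iff_of_symmDiff_eq hG h
  have hR' := odd_degS_iff_of_symmDiff_eq hG h'
  refine ⟨P', Q', hP', hQ', h', h1, Set.ext fun x => ?_, Set.ext fun x => ?_⟩
  · have h₁ := (hx x).1
    have h₂ := hR x
    have h₃ := hR' x
    simp only [commonOdd, Set.mem_ofPred_eq]
    tauto
  · have h₁ := (hx x).2
    have h₂ := hR x
    have h₃ := hR' x
    simp only [commonOdd, Set.mem_ofPred_eq]
    tauto

/-- Three linear forests whose symmetric difference is Eulerian can be completed to paths
if the first two have an odd number of common leaves. -/
lemma exists_paths_of_linearForests (hG : ∀ x, Even (degS G x))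
    (h : symmDiff P (symmDiff Q R) = G) (hP : IsLinearForest P)
    (hQ : IsLinearForest Q) (hR : IsLinearForest R) (hodd : Odd (commonOdd P Q).ncard) :
    ∃ P' Q' R', IsPathGraph P' ∧ IsPathGraph Q' ∧ IsPathGraph R' ∧
      symmDiff P' (symmDiff Q' R') = G := by
  have hPR := odd_ncard_commonOdd hG h hodd
  have hQR := odd_ncard_commonOdd hG ((symmDiff_left_comm Q P R).trans h)
    (by rwa [commonOdd_comm])
  obtain ⟨P₁, Q₁, hP₁, hQ₁, hs₁, hc₁, hPR₁, hQR₁⟩ := exists_merge_of_symmDiff_eq hG h hP hQ hodd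
  obtain ⟨P₂, R₂, hP₂, hR₂, hs₂, hc₂, hPQ₂, hRQ₂⟩ := exists_merge_of_symmDiff_eq hG
    (R := Q₁) (by rwa [symmDiff_comm R]) hP₁ hR (by rwa [hPR₁])
  obtain ⟨Q₃, R₃, hQ₃, hR₃, hs₃, hc₃, hQP₃, hRP₃⟩ := exists_merge_of_symmDiff_eq hG
    (R := P₂) (by rwa [symmDiff_comm, symmDiff_comm R₂, symmDiff_assoc]) hQ₁ hR₂
    (by rwa [commonOdd_comm, hRQ₂, commonOdd_comm, hQR₁])
  have hs : symmDiff P₂ (symmDiff Q₃ R₃) = G := by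
    rw [← hs₃, symmDiff_comm, symmDiff_assoc]
  rw [commonOdd_comm, ← hRP₃, commonOdd_comm] at hc₂
  rw [← hPQ₂, commonOdd_comm, ← hQP₃] at hc₁
  refine ⟨P₂, Q₃, R₃, hP₂.isPathGraph ?_, hQ₃.isPathGraph ?_, hR₃.isPathGraph ?_, hs⟩
  · rw [ncard_odd_degS_eq hG hs, commonOdd_comm, hc₁, hc₂]
  · rw [ncard_odd_degS_eq hG hs₃, hc₃, hc₁]
  · rw [ncard_odd_degS_eq hG ((symmDiff_left_comm _ _ _).trans hs₃), commonOdd_comm, hc₃,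
      commonOdd_comm, hc₂]

end Triple

end Merging

section Peeling

variable {α : Type*} [Finite α] {F H : SimpleGraph α}

/-- Moving an edge from one of two disjoint graphs to the other. -/
lemma move_edge (hd : Disjoint F H) {x y : α} (h : F.Adj x y) :
    Disjoint (F \ edge x y) (H ⊔ edge x y) ∧ F \ edge x y ⊔ (H ⊔ edge x y) = F ⊔ H ∧
      F \ edge x y < F ∧ ∀ z, degS (F \ edge x y) z + degS (edge x y) z = degS F z ∧
        degS (H ⊔ edge x y) z = degS H z + degS (edge x y) z := by
  have hle : edge x y ≤ F := by simpa [edge_le_iff] using Or.inr h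
  have hdH : Disjoint H (edge x y) := hd.symm.mono_right hle
  refine ⟨disjoint_sup_right.2 ⟨hd.mono_left sdiff_le, disjoint_sdiff_self_left⟩, ?_, ?_,
    fun z => ⟨degS_sdiff_edge_add h z, degS_sup_of_disjoint hdH z⟩⟩
  · rw [sup_comm H, ← sup_assoc, sdiff_sup_cancel hle]
  · refine lt_of_le_of_ne sdiff_le fun heq => ?_
    have := heq ▸ h
    simp [edge_adj, h.ne] at this

/-- The cycles of `F` can be broken by moving a matching of edges of `F` avoiding `w` to `H`. -/
lemma exists_peel_matching {w : α} (hd : Disjoint F H) (hF : ∀ x, degS F x ≤ 2)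
    (hH : ∀ x, degS H x ≤ 1) (h : ∀ x, degS F x = 2 → degS H x = 0) (hw : degS H w = 0) :
    ∃ F' H', Disjoint F' H' ∧ F' ⊔ H' = F ⊔ H ∧ F' ≤ F ∧ H ≤ H' ∧ IsLinearForest F' ∧
      (∀ x, degS H' x ≤ 1) ∧ degS H' w = 0 := by
  induction F using WellFoundedLT.induction generalizing H with
  | _ F ih =>
    by_cases hac : F.IsAcyclic
    · exact ⟨F, H, hd, rfl, le_rfl, le_rfl, ⟨hac, hF⟩, hH, hw⟩
    obtain ⟨K, ⟨x, hx⟩, hK⟩ := exists_core_of_not_isAcyclic hac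
    have hK2 : ∀ a ∈ K, degS F a = 2 := fun a ha => by
      obtain ⟨b, -, c, -, hbc, hb, hc⟩ := hK a ha
      exact (hF a).antisymm (two_le_degS hb hc hbc)
    obtain ⟨a, ha, haw⟩ : ∃ a ∈ K, a ≠ w := by
      obtain ⟨y, hy, -, -, -, hxy, -⟩ := hK x hx
      by_cases hxw : x = w
      · exact ⟨y, hy, fun hyw => hxy.ne (hxw.trans hyw.symm)⟩
      · exact ⟨x, hx, hxw⟩
    obtain ⟨b, hb, hbw, hab⟩ : ∃ b ∈ K, b ≠ w ∧ F.Adj a b := by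
      obtain ⟨y, hy, z, hz, hyz, hay, haz⟩ := hK a ha
      by_cases hyw : y = w
      · exact ⟨z, hz, fun hzw => hyz (hyw.trans hzw.symm), haz⟩
      · exact ⟨y, hy, hyw, hay⟩
    obtain ⟨hd', hs, hlt, hdeg⟩ := move_edge hd hab
    have hedge : ∀ z, degS (edge a b) z = 0 ∨ degS (edge a b) z = 1 ∧ degS F z = 2 := by
      intro z
      by_cases hza : z = a
      · rw [hza]
        exact .inr ⟨degS_edge_left hab.ne, hK2 a ha⟩
      by_cases hzb : z = b
      · rw [hzb]
        exact .inr ⟨degS_edge_right hab.ne, hK2 b hb⟩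
      exact .inl (degS_edge_of_ne hza hzb)
    obtain ⟨F', H', h₁, h₂, h₃, h₄, h₅⟩ := ih _ hlt hd'
      (fun z => (degS_mono sdiff_le z).trans (hF z))
      (fun z => by have := hdeg z; have := hedge z; have := h z; have := hH z; omega)
      (fun z => by have := hdeg z; have := hedge z; have := h z; have := hF z; omega)
      (by rw [(hdeg w).2, hw, degS_edge_of_ne haw.symm hbw.symm])
    exact ⟨F', H', h₁, h₂.trans hs, h₃.trans sdiff_le, le_sup_left.trans h₄, h₅⟩

/-- The cycles of `F` can be broken by moving edges to the linear forest `H`. -/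
lemma exists_peel_linearForest (hd : Disjoint F H) (hF : ∀ x, degS F x ≤ 2)
    (hH : IsLinearForest H) (h : ∀ x, degS F x = 2 → degS H x ≤ 1) :
    ∃ F' H', Disjoint F' H' ∧ F' ⊔ H' = F ⊔ H ∧ F' ≤ F ∧ H ≤ H' ∧ IsLinearForest F' ∧
      IsLinearForest H' := by
  induction F using WellFoundedLT.induction generalizing H with
  | _ F ih =>
    by_cases hac : F.IsAcyclic
    · exact ⟨F, H, hd, rfl, le_rfl, le_rfl, ⟨hac, hF⟩, hH⟩
    obtain ⟨K, ⟨x, hx⟩, hK⟩ := exists_core_of_not_isAcyclic hac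
    have hK1 : ∀ a ∈ K, degS H a ≤ 1 := fun a ha => by
      obtain ⟨b, -, c, -, hbc, hb, hc⟩ := hK a ha
      exact h a ((hF a).antisymm (two_le_degS hb hc hbc))
    obtain ⟨a, ha, hxa, hr⟩ : ∃ a ∈ K, F.Adj x a ∧ ¬H.Reachable x a := by
      obtain ⟨y, hy, z, hz, hyz, hxy, hxz⟩ := hK x hx
      by_cases hr : H.Reachable x y
      · exact ⟨z, hz, hxz, not_reachable_of_degS_le_one hH.2 (hK1 x hx) (hK1 y hy) (hK1 z hz)
          hxy.ne hxz.ne hyz hr⟩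
      · exact ⟨y, hy, hxy, hr⟩
    obtain ⟨hd', hs, hlt, hdeg⟩ := move_edge hd hxa
    obtain ⟨F', H', h₁, h₂, h₃, h₄, h₅⟩ := ih _ hlt hd'
      (fun z => (degS_mono sdiff_le z).trans (hF z))
      (hH.sup_edge (hK1 x hx) (hK1 a ha) hr)
      (fun z => by have := hdeg z; have := h z; have := hF z; omega)
    exact ⟨F', H', h₁, h₂.trans hs, h₃.trans sdiff_le, le_sup_left.trans h₄, h₅⟩

end Peeling

section Orientation

variable {α : Type*}

lemma List.Nodup.ncard_mem_fst [DecidableEq α] {L : List (α × α)} (hL : L.Nodup) (x : α) :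
    {y | (x, y) ∈ L}.ncard = (L.map Prod.fst).count x := by
  induction L with
  | nil => simp
  | cons p L ih =>
    obtain ⟨a, b⟩ := p
    obtain ⟨hp, hL⟩ := List.nodup_cons.1 hL
    have hfin : {y | (x, y) ∈ L}.Finite :=
      (L.finite_toSet.preimage (f := fun y => (x, y)) fun _ _ _ _ h => congrArg Prod.snd h)
    by_cases hax : a = x
    · subst hax
      have hs : {y | (a, y) ∈ (a, b) :: L} = insert b {y | (a, y) ∈ L} := by
        ext y
        simp
      rw [hs, Set.ncard_insert_of_notMem (s := {y | (a, y) ∈ L}) hp hfin, ih hL]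
      simp
    · have hs : {y | (x, y) ∈ (a, b) :: L} = {y | (x, y) ∈ L} := by
        ext y
        simp [Ne.symm hax]
      rw [hs, ih hL]
      simp [hax]

lemma List.Nodup.ncard_mem_snd [DecidableEq α] {L : List (α × α)} (hL : L.Nodup) (x : α) :
    {y | (y, x) ∈ L}.ncard = (L.map Prod.snd).count x := by
  have := (hL.map Prod.swap_injective).ncard_mem_fst x
  simpa [Function.comp_def] using this

/-- A closed trail traverses each of its edges in one direction, and it leaves each vertex as
often as it enters it. -/
lemma SimpleGraph.Walk.IsTrail.exists_orientation {G : SimpleGraph α} {u : α} {c : G.Walk u u}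
    (hc : c.IsTrail) : ∃ O : α → α → Prop, (∀ x y, s(x, y) ∈ c.edges ↔ O x y ∨ O y x) ∧
      (∀ x y, O x y → ¬O y x) ∧ ∀ x, {y | O x y}.ncard = {y | O y x}.ncard := by
  classical
  have hnd : (c.darts.map Dart.toProd).Nodup :=
    (hc.edges_nodup.of_map _).map Dart.toProd_injective
  refine ⟨fun x y => (x, y) ∈ c.darts.map Dart.toProd, fun x y => ?_, fun x y h h' => ?_,
    fun x => ?_⟩
  · simp only [Walk.edges, List.mem_map]
    constructor
    · rintro ⟨d, hd, he⟩
      rcases dart_edge_eq_mk'_iff.1 he with h | h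
      · exact .inl ⟨d, hd, h⟩
      · exact .inr ⟨d, hd, h⟩
    · rintro (⟨d, hd, h⟩ | ⟨d, hd, h⟩)
      · exact ⟨d, hd, dart_edge_eq_mk'_iff.2 (.inl h)⟩
      · exact ⟨d, hd, dart_edge_eq_mk'_iff.2 (.inr h)⟩
  · obtain ⟨d, hd, hdx⟩ := List.mem_map.1 h
    obtain ⟨d', hd', hdx'⟩ := List.mem_map.1 h'
    have := List.inj_on_of_nodup_map hc.edges_nodup hd hd'
      ((dart_edge_eq_mk'_iff.2 (.inl hdx)).trans (dart_edge_eq_mk'_iff.2 (.inr hdx')).symm)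
    subst this
    have hxy := d.adj.ne
    rw [hdx] at hdx' hxy
    exact hxy (congrArg Prod.fst hdx')
  · rw [hnd.ncard_mem_fst, hnd.ncard_mem_snd]
    have h₁ : c.support.dropLast ++ [u] = u :: c.support.tail := by
      rw [c.cons_tail_support]
      conv_rhs => rw [← List.dropLast_append_getLast c.support_ne_nil]
      simp
    have h₂ := congrArg (List.count x) h₁
    have h₃ : (c.darts.map Dart.toProd).map Prod.fst = c.support.dropLast := by
      rw [← c.map_fst_darts, List.map_map]
      rfl
    have h₄ : (c.darts.map Dart.toProd).map Prod.snd = c.support.tail := by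
      rw [← c.map_snd_darts, List.map_map]
      rfl
    rw [h₃, h₄]
    simp only [List.count_append, List.count_cons, List.count_nil] at h₂
    omega

variable [Finite α] {G : SimpleGraph α}

lemma degS_eq_add_of_orientation {O : α → α → Prop} (h₁ : ∀ x y, G.Adj x y ↔ O x y ∨ O y x)
    (h₂ : ∀ x y, O x y → ¬O y x) (x : α) :
    degS G x = {y | O x y}.ncard + {y | O y x}.ncard := by
  have hd : Disjoint {y | O x y} {y | O y x} := Set.disjoint_left.2 fun y => h₂ x y
  rw [degS, ← Set.ncard_union_eq hd (Set.toFinite _) (Set.toFinite _)]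
  congr 1
  ext y
  exact h₁ x y

/-- An Eulerian graph has an orientation with equal in- and out-degrees. -/
lemma exists_balanced_orientation (hG : ∀ x, Even (degS G x)) :
    ∃ O : α → α → Prop, (∀ x y, G.Adj x y ↔ O x y ∨ O y x) ∧
      (∀ x y, O x y → ¬O y x) ∧ ∀ x, {y | O x y}.ncard = {y | O y x}.ncard := by
  induction G using WellFoundedLT.induction with
  | _ G ih =>
    by_cases hac : G.IsAcyclic
    · refine ⟨fun _ _ => False, fun x y => ?_, by simp, by simp⟩
      simp only [or_self, iff_false]
      intro h
      obtain ⟨w, -, -, hw⟩ := hac.exists_reachable_degS_eq_one (degS_pos h)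
      exact absurd (hG w) (by simp [hw])
    simp only [IsAcyclic, not_forall, not_not] at hac
    obtain ⟨u, c, hc⟩ := hac
    obtain ⟨O, hO₁, hO₂, hO₃⟩ := hc.isTrail.exists_orientation
    set D := fromEdgeSet {e | e ∈ c.edges} with hD
    have hDadj : ∀ x y, D.Adj x y ↔ O x y ∨ O y x := fun x y => by
      rw [← hO₁, hD, fromEdgeSet_adj]
      exact ⟨And.left, fun h => ⟨h, (c.adj_of_mem_edges h).ne⟩⟩
    have hDG : D ≤ G := fun x y h => c.adj_of_mem_edges ((hO₁ x y).2 ((hDadj x y).1 h))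
    have hdeg : ∀ x, degS (G \ D) x + degS D x = degS G x := fun x => by
      rw [← degS_sup_of_disjoint disjoint_sdiff_self_left, sdiff_sup_cancel hDG]
    have hlt : G \ D < G := by
      refine lt_of_le_of_ne sdiff_le fun heq => ?_
      have hpos : 0 < c.edges.length := by
        rw [c.length_edges]
        have := hc.three_le_length
        omega
      obtain ⟨e, he⟩ := List.exists_mem_of_length_pos hpos
      induction e with
      | _ x y =>
        have h := c.adj_of_mem_edges he
        rw [← heq] at h
        exact h.2 ((hDadj x y).2 ((hO₁ x y).1 he))
    obtain ⟨O', hO₁', hO₂', hO₃'⟩ := ih _ hlt fun x => by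
      have h₁ := degS_eq_add_of_orientation hDadj hO₂ x
      have h₂ := hG x
      rw [← hdeg x, h₁, hO₃ x] at h₂
      simpa [Nat.even_add] using h₂
    have hdisj : ∀ x y, O' x y ∨ O' y x → ¬(O x y ∨ O y x) := fun x y h h' =>
      ((hO₁' x y).2 h).2 ((hDadj x y).2 h')
    refine ⟨fun x y => O' x y ∨ O x y, fun x y => ?_, fun x y => ?_, fun x => ?_⟩
    · have h₁ := hO₁' x y
      have h₂ := hDadj x y
      have h₃ := @hDG x y
      rw [sdiff_adj] at h₁
      tauto
    · have := hdisj x y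
      have := hO₂ x y
      have := hO₂' x y
      tauto
    · rw [Set.ofPred_or, Set.ofPred_or,
        Set.ncard_union_eq _ (Set.toFinite _) (Set.toFinite _),
        Set.ncard_union_eq _ (Set.toFinite _) (Set.toFinite _), hO₃, hO₃']
      · exact Set.disjoint_left.2 fun y h h' => hdisj y x (.inl h) (.inl h')
      · exact Set.disjoint_left.2 fun y h h' => hdisj x y (.inl h) (.inl h')

end Orientation

section TwoFactor

variable {α : Type*} [Finite α] {G : SimpleGraph α}

/-- A relation all of whose rows and columns have weighted sum two contains a permutation. -/
lemma exists_perm_of_weight [Fintype α] [DecidableEq α] (w : α → α → ℕ)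
    (hrow : ∀ x, ∑ y, w x y = 2) (hcol : ∀ y, ∑ x, w x y = 2) :
    ∃ f : Equiv.Perm α, ∀ x, w x (f x) ≠ 0 := by
  obtain ⟨f, hf, hw⟩ := (Finset.all_card_le_biUnion_card_iff_exists_injective
    fun x => Finset.univ.filter fun y => w x y ≠ 0).1 fun s => by
      set t := s.biUnion fun x => Finset.univ.filter fun y => w x y ≠ 0
      have h₁ : ∑ x ∈ s, ∑ y ∈ t, w x y = 2 * s.card := by
        rw [Finset.sum_congr rfl fun x hx => ?_, Finset.sum_const, smul_eq_mul, mul_comm]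
        rw [← hrow x]
        refine Finset.sum_subset (Finset.subset_univ _) fun y _ hy => ?_
        by_contra h
        exact hy (Finset.mem_biUnion.2 ⟨x, hx, by simpa using h⟩)
      have h₂ : ∑ x ∈ s, ∑ y ∈ t, w x y ≤ 2 * t.card := by
        rw [Finset.sum_comm, mul_comm, ← smul_eq_mul, ← Finset.sum_const]
        exact Finset.sum_le_sum fun y _ =>
          (Finset.sum_le_sum_of_subset (Finset.subset_univ _)).trans (hcol y).le
      omega
  exact ⟨Equiv.ofBijective f (Finite.injective_iff_bijective.1 hf), fun x => by simpa using hw x⟩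

/-- Petersen's theorem: an Eulerian graph of maximum degree at most four is the union of two
Eulerian graphs of maximum degree at most two. -/
lemma exists_two_factor (hG : ∀ x, Even (degS G x)) (h4 : ∀ x, degS G x ≤ 4) :
    ∃ A ≤ G, ∀ x, degS A x ≤ 2 ∧ degS (G \ A) x ≤ 2 ∧ Even (degS A x) := by
  classical
  cases nonempty_fintype α
  obtain ⟨O, hO₁, hO₂, hO₃⟩ := exists_balanced_orientation hG
  have hdeg := degS_eq_add_of_orientation hO₁ hO₂
  have hirr : ∀ x, ¬O x x := fun x h => hO₂ x x h h
  have hsum : ∀ p : α → Prop, ∑ y, (if p y then 1 else 0) = {y | p y}.ncard := fun p => by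
    rw [Finset.sum_boole, Set.ncard_eq_toFinset_card']
    simp
  have hout : ∀ x, {y | O x y}.ncard ≤ 2 := fun x => by
    have := hdeg x
    have := hO₃ x
    have := h4 x
    omega
  obtain ⟨f, hf⟩ := exists_perm_of_weight
    (fun x y => (if O x y then 1 else 0) + if x = y then 2 - {y | O x y}.ncard else 0)
    (fun x => by
      rw [Finset.sum_add_distrib, hsum, Finset.sum_ite_eq, if_pos (Finset.mem_univ x)]
      have := hout x
      omega)
    (fun y => by
      rw [Finset.sum_add_distrib, hsum, Finset.sum_ite_eq', if_pos (Finset.mem_univ y), ← hO₃]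
      have := hout y
      omega)
  have hfO : ∀ x, f x ≠ x → O x (f x) := fun x hx => by
    by_contra h
    exact hf x (by simp [h, Ne.symm hx])
  have hfx : ∀ x, degS G x = 4 → f x ≠ x := fun x hx h => by
    have h₁ := hdeg x
    have h₂ := hO₃ x
    have := hf x
    rw [h] at this
    simp only [hirr x, if_true, if_false] at this
    omega
  let A := fromRel fun x y => f x = y
  have hA : ∀ x y, A.Adj x y ↔ x ≠ y ∧ (f x = y ∨ f y = x) := fun x y => fromRel_adj _ x y
  have hAG : A ≤ G := fun x y h => by
    obtain ⟨hne, rfl | h⟩ := (hA x y).1 h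
    · exact (hO₁ _ _).2 (.inl (hfO x hne.symm))
    · subst h
      exact (hO₁ _ _).2 (.inr (hfO y hne))
  have hAdeg : ∀ x, degS A x = if f x = x then 0 else 2 := fun x => by
    split_ifs with hx
    · rw [degS, Set.ncard_eq_zero (Set.toFinite _), Set.eq_empty_iff_forall_notMem]
      rintro y hy
      obtain ⟨hne, h | h⟩ := (hA x y).1 hy
      · exact hne (hx.symm.trans h)
      · exact hne (f.injective (hx.trans h.symm))
    · have hx' : f.symm x ≠ x := fun h => hx (by rw [Equiv.symm_apply_eq] at h; exact h.symm)
      have hne : f x ≠ f.symm x := fun h => by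
        have h₁ := hfO _ hx
        have h₂ := hfO (f.symm x) (by simpa using hx'.symm)
        rw [Equiv.apply_symm_apply, ← h] at h₂
        exact hO₂ _ _ h₁ h₂
      rw [degS, ← Set.ncard_pair hne]
      congr 1
      ext y
      simp only [mem_neighborSet, hA, Set.mem_insert_iff, Set.mem_singleton_iff,
        Equiv.eq_symm_apply]
      constructor
      · rintro ⟨-, h | h⟩
        · exact .inl h.symm
        · exact .inr h
      · rintro (rfl | h)
        · exact ⟨Ne.symm hx, .inl rfl⟩
        · exact ⟨fun hxy => hx (by rw [← hxy] at h; exact h), .inr h⟩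
  refine ⟨A, hAG, fun x => ?_⟩
  have hadd : degS (G \ A) x + degS A x = degS G x := by
    rw [← degS_sup_of_disjoint disjoint_sdiff_self_left, sdiff_sup_cancel hAG]
  rw [hAdeg] at hadd ⊢
  have h₁ := h4 x
  obtain ⟨k, hk⟩ := hG x
  split_ifs at hadd ⊢ with hx
  · have : degS G x ≠ 4 := fun h => hfx x h hx
    exact ⟨by omega, by omega, by simp⟩
  · exact ⟨le_rfl, by omega, by decide⟩

end TwoFactor

section Decomposition

variable {α : Type*} [Finite α] {G P Q R : SimpleGraph α}

/-- Three linear forests with Eulerian symmetric difference can be completed to paths if an edge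
joining a leaf to a non-leaf of `Q` can be toggled in both other forests, as this changes the parity
of the number of common leaves of `P` and `Q`. -/
lemma exists_paths_of_toggle (hG : ∀ x, Even (degS G x)) (h : symmDiff P (symmDiff Q R) = G)
    (hP : IsLinearForest P) (hQ : IsLinearForest Q) (hR : IsLinearForest R) {v w : α}
    (hvw : v ≠ w) (hP' : IsLinearForest (symmDiff P (edge v w)))
    (hR' : IsLinearForest (symmDiff R (edge v w))) (hv : Odd (degS Q v))
    (hw : Even (degS Q w)) : ∃ P' Q' R', IsPathGraph P' ∧ IsPathGraph Q' ∧ IsPathGraph R' ∧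
      symmDiff P' (symmDiff Q' R') = G := by
  by_cases hodd : Odd (commonOdd P Q).ncard
  · exact exists_paths_of_linearForests hG h hP hQ hR hodd
  refine exists_paths_of_linearForests hG ?_ hP' hQ hR' ?_
  · rw [← symmDiff_assoc Q, symmDiff_symmDiff_symmDiff_comm, symmDiff_self, symmDiff_bot, h]
  · have hs : commonOdd (symmDiff P (edge v w)) Q = symmDiff (commonOdd P Q) {v} := by
      ext x
      simp only [commonOdd, Set.mem_symmDiff, Set.mem_ofPred_eq, Set.mem_singleton_iff,
        odd_degS_symmDiff]
      by_cases hxv : x = v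
      · subst hxv
        simp [degS_edge_left hvw, hv]
      by_cases hxw : x = w
      · subst hxw
        simp [hw, Ne.symm hvw]
      · simp [degS_edge_of_ne hxv hxw, hxv]
    rw [hs, Set.odd_ncard_symmDiff]
    simp [hodd]

/-- The graph is partitioned into three linear forests `P`, `Q` and `R`, such that
`exists_paths_of_toggle` applies to an edge of `R` joining a leaf of `Q` to a non-leaf of `Q`. -/
lemma exists_paths_of_maxDegree_four (hG : ∀ x, Even (degS G x)) (h4 : ∀ x, degS G x ≤ 4)
    (hmax : ∃ v, degS G v = 4) :
    ∃ P Q R, IsPathGraph P ∧ IsPathGraph Q ∧ IsPathGraph R ∧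
      symmDiff P (symmDiff Q R) = G := by
  obtain ⟨v, hv⟩ := hmax
  obtain ⟨A, hAG, hA⟩ := exists_two_factor hG h4
  set B := G \ A with hB
  have hAB : Disjoint A B := disjoint_sdiff_self_right
  have hsup : A ⊔ B = G := by rw [sup_comm, hB, sdiff_sup_cancel hAG]
  have hdeg : ∀ x, degS A x + degS B x = degS G x := fun x => by
    rw [← degS_sup_of_disjoint hAB, hsup]
  have hBe : ∀ x, Even (degS B x) := fun x => by
    have := hG x
    rw [← hdeg] at this
    exact (Nat.even_add.1 this).1 (hA x).2.2
  have hAv : degS A v = 2 := by have := hdeg v; have := hA v; omega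
  have hBv : degS B v = 2 := by have := hdeg v; have := hA v; omega
  obtain ⟨w, hvw⟩ := exists_adj_of_degS_pos (F := A) (x := v) (by omega)
  have hAw : degS A w = 2 := by
    have := degS_pos hvw.symm
    obtain ⟨h₁, -, k, hk⟩ := hA w
    omega
  obtain ⟨w', hww', hw'v⟩ := exists_adj_ne_of_two_le_degS hAw.ge v
  obtain ⟨z, hvz, hzw'⟩ := exists_adj_ne_of_two_le_degS hBv.ge w'
  have hzw : z ≠ w := fun h => disjoint_left.1 hAB v z (h ▸ hvw) hvz
  -- a linear forest `Q ≤ B` whose complement in `B` is a matching `M` through `v`, avoiding `w`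
  have hBz := degS_sdiff_edge_add hvz
  obtain ⟨Q, M, hQM, hQMB, -, hzM, hQ, hM, hMw⟩ := exists_peel_matching (F := B \ edge v z)
    (H := edge v z) (w := w) disjoint_sdiff_self_left
    (fun x => (degS_mono sdiff_le x).trans (hA x).2.1) (degS_edge_le_one v z)
    (fun x hx => by have := hBz x; have := (hA x).2.1; omega)
    (degS_edge_of_ne hvw.ne' hzw.symm)
  rw [sdiff_sup_cancel (by simpa [edge_le_iff] using Or.inr hvz)] at hQMB
  have hQB : ∀ x, degS Q x + degS M x = degS B x := fun x => by
    rw [← degS_sup_of_disjoint hQM, hQMB]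
  have hMvz : M.Adj v z := hzM (by simp [edge_adj, hvz.ne])
  have hMv : degS M v = 1 := (hM v).antisymm (degS_pos hMvz)
  -- `M` together with the edges `ww'` and `vw` is a linear forest
  have hMww' : ¬M.Reachable w w' := not_reachable_of_degS_eq_zero hMw hww'.ne
  have hM₁ := IsLinearForest.sup_edge ⟨isAcyclic_of_degS_le_one hM, fun x => by grind⟩ (hM w)
    (hM w') hMww'
  set M₁ := M ⊔ edge w w' with hM₁_def
  have hdegM₁ : ∀ x, degS M₁ x = degS M x + degS (edge w w') x :=
    degS_sup_of_disjoint ((disjoint_edge _).2 (not_adj_of_not_reachable hMww'))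
  have hM₁v : degS M₁ v = 1 := by
    rw [hdegM₁, hMv, degS_edge_of_ne hvw.ne hw'v.symm]
  have hM₁w : degS M₁ w = 1 := by rw [hdegM₁, hMw, degS_edge_left hww'.ne]
  have hM₁z : degS M₁ z ≤ 1 := by
    rw [hdegM₁, degS_edge_of_ne hzw hzw']
    exact hM z
  have hM₁vw : ¬M₁.Reachable v w := not_reachable_of_degS_le_one hM₁.2 hM₁v.le hM₁z hM₁w.le
    hvz.ne hvw.ne hzw (Adj.reachable (Or.inl hMvz))
  have hM₂ := hM₁.sup_edge hM₁v.le hM₁w.le hM₁vw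
  set M₂ := M₁ ⊔ edge v w with hM₂_def
  have hdegM₂ : ∀ x, degS M₂ x = degS M₁ x + degS (edge v w) x :=
    degS_sup_of_disjoint ((disjoint_edge _).2 (not_adj_of_not_reachable hM₁vw))
  -- remove these edges from `A`
  have hA₁ww' : (A \ edge v w).Adj w w' := ⟨hww', by simp [edge_adj, hw'v, hvw.ne']⟩
  have hdegA₁ := degS_sdiff_edge_add hvw
  have hdegA₂ := degS_sdiff_edge_add hA₁ww'
  set A₂ := (A \ edge v w) \ edge w w' with hA₂_def
  have hA₂A : A₂ ≤ A := sdiff_le.trans sdiff_le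
  have hMB : M ≤ B := hQMB ▸ le_sup_right
  have hA₂M₂ : Disjoint A₂ M₂ := by
    rw [hM₂_def, hM₁_def, disjoint_sup_right, disjoint_sup_right]
    exact ⟨⟨hAB.mono hA₂A hMB, disjoint_sdiff_self_left⟩,
      disjoint_sdiff_self_left.mono_left sdiff_le⟩
  have hA₂M₂sup : A₂ ⊔ M₂ = A ⊔ M := by
    have h₁ : edge w w' ≤ A \ edge v w := by simpa only [edge_le_iff] using Or.inr hA₁ww'
    have h₂ : edge v w ≤ A := by simpa only [edge_le_iff] using Or.inr hvw
    rw [hM₂_def, hM₁_def, sup_comm M, sup_assoc, sup_comm M, ← sup_assoc, hA₂_def,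
      sdiff_sup_cancel h₁, ← sup_assoc, sdiff_sup_cancel h₂]
  obtain ⟨P, R, hPR, hPRs, hPA, hMR, hP, hR⟩ := exists_peel_linearForest hA₂M₂
    (fun x => (degS_mono hA₂A x).trans (hA x).1) hM₂ fun x hx => by
      have := hdegA₁ x
      have := hdegA₂ x
      have := hdegM₁ x
      have := hdegM₂ x
      have := hM x
      have := (hA x).1
      omega
  rw [hA₂M₂sup] at hPRs
  have hQPR : Disjoint Q (P ⊔ R) := by
    rw [hPRs, disjoint_sup_right]
    exact ⟨hAB.symm.mono_left (hQMB ▸ le_sup_left), hQM⟩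
  have hs : symmDiff P (symmDiff Q R) = G := by
    rw [symmDiff_left_comm, hPR.symmDiff_eq_sup, hQPR.symmDiff_eq_sup, hPRs, sup_left_comm,
      hQMB, hsup]
  have hvwR : edge v w ≤ R := le_sup_right.trans hMR
  have hPw : degS P w = 0 := by
    have := degS_mono hPA w
    have := hdegA₁ w
    have := hdegA₂ w
    rw [degS_edge_left hww'.ne] at this
    have := degS_edge_right hvw.ne
    omega
  have hPv : degS P v ≤ 1 := by
    have := degS_mono hPA v
    have := hdegA₁ v
    have := hdegA₂ v
    have := degS_edge_left hvw.ne
    omega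
  have hPvw : ¬P.Reachable v w := fun h => not_reachable_of_degS_eq_zero hPw hvw.ne' h.symm
  refine exists_paths_of_toggle hG hs hP hQ hR hvw.ne ?_ (hR.mono ?_) ?_ ?_
  · rw [((disjoint_edge P).2 (not_adj_of_not_reachable hPvw)).symmDiff_eq_sup]
    exact hP.sup_edge hPv (by omega) hPvw
  · rw [symmDiff_of_ge hvwR]
    exact sdiff_le
  · have := hQB v
    rw [hMv, hBv] at this
    have : degS Q v = 1 := by omega
    simp [this]
  · have := hQB w
    rw [hMw, add_zero] at this
    rw [this]
    exact hBe w

end Decomposition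

/-- Every Eulerian graph of maximum degree 4 admits a path odd-cover of size at
most 3. -/
theorem eulerian_maxDegree_four_path_oddCover_three
    {α : Type*} [Fintype α] (G : SimpleGraph α)
    (hEuler : ∀ v, Even (degS G v))
    (hle : ∀ v, degS G v ≤ 4) (hmax : ∃ v, degS G v = 4) :
    ∃ L : List (SimpleGraph α), L.length ≤ 3 ∧
      (∀ P ∈ L, IsPathGraph P) ∧ listSymmDiff L = G := by
  obtain ⟨P, Q, R, hP, hQ, hR, h⟩ := exists_paths_of_maxDegree_four hEuler hle hmax
  exact ⟨[P, Q, R], by simp, by simp [hP, hQ, hR], by simpa [listSymmDiff] using h⟩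
end
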